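/- Let H be a bipartite graph on h vertices with hcf(H) = 1, σ(H) = u and w = h − σ(H). For every α > 0 there exist γ > 0 and a positive integer m_0 such that for every balanced bipartite graph G[X,Y] on 2n = mh vertices with m ≥ m_0 and δ(G) ≥ (1 − 1/χ_cr(H) − γ)n, either G contains an H-factor or there exist sets A ⊆ X, B ⊆ Y with |A| = |B| = ⌊wn/h⌋ and density d(A,B) ≤ α. -/

import Mathlib

open Finset

attribute [local instance] Classical.propDecidable

namespace BipTiling

variable {α β V : Type*}

/-- A proper 2-coloring of the graph `H`. -/
def Proper2Coloring (H : SimpleGraph α) (c : α → Bool) : Prop :=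
  ∀ ⦃a b : α⦄, H.Adj a b → c a ≠ c b

/-- `H` is bipartite, i.e. it admits a proper 2-coloring. -/
def IsBip (H : SimpleGraph α) : Prop :=
  ∃ c : α → Bool, Proper2Coloring H c

/-- The size of the color class of color `i` under the 2-coloring `c`. -/
noncomputable def colorCard [Fintype α] (c : α → Bool) (i : Bool) : ℕ :=
  (Finset.univ.filter fun v => c v = i).card

/-- `σ(H)`: the smallest size of a color class over all proper 2-colorings of `H`. -/
noncomputable def sigmaBip [Fintype α] (H : SimpleGraph α) : ℕ :=
  sInf {k | ∃ c : α → Bool, Proper2Coloring H c ∧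
    k = min (colorCard c true) (colorCard c false)}

/-- The finset of connected components of `H`. -/
noncomputable def comps [Fintype α] (H : SimpleGraph α) : Finset H.ConnectedComponent :=
  Finset.univ.image H.connectedComponentMk

/-- `c_i`: the number of vertices of the connected component `K`. -/
noncomputable def compCard [Fintype α] (H : SimpleGraph α) (K : H.ConnectedComponent) : ℕ :=
  (Finset.univ.filter fun v => H.connectedComponentMk v = K).card

/-- `d_i = |W_i| - |U_i|`: the (absolute) difference of the sizes of the two color classes
of the component `K`, computed with respect to a proper 2-coloring `c` of `H`.
(For a proper 2-coloring this is independent of the choice of `c`, since the 2-coloring of a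
connected bipartite graph is unique up to swapping the colors.) -/
noncomputable def compDiff [Fintype α] (H : SimpleGraph α) (c : α → Bool)
    (K : H.ConnectedComponent) : ℕ :=
  (((Finset.univ.filter fun v => H.connectedComponentMk v = K ∧ c v = true).card : ℤ) -
    ((Finset.univ.filter fun v => H.connectedComponentMk v = K ∧ c v = false).card : ℤ)).natAbs

/-- `hcf_c(H) = gcd(c_1, …, c_k)`. -/
noncomputable def hcfC [Fintype α] (H : SimpleGraph α) : ℕ :=
  (comps H).gcd (compCard H)

/-- `hcf_{χ,c}(H) = gcd(d_1, …, d_k)`, with respect to a proper 2-coloring `c`. -/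
noncomputable def hcfChiC [Fintype α] (H : SimpleGraph α) (c : α → Bool) : ℕ :=
  (comps H).gcd (compDiff H c)

/-- `x_2 - x_1` for the 2-coloring `c`, where `x_1 ≤ x_2` are the sizes of its color classes. -/
noncomputable def colorDiff [Fintype α] (c : α → Bool) : ℕ :=
  ((colorCard c true : ℤ) - (colorCard c false : ℤ)).natAbs

/-- `hcf_χ(H)`: the gcd of the set `D(H)` of all differences `x_2 - x_1` of color class sizes
over all proper 2-colorings of `H` (`0` represents `∞`, i.e. `D(H) = {0}`). -/
noncomputable def hcfChi [Fintype α] (H : SimpleGraph α) : ℕ :=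
  (Finset.univ.filter fun c : α → Bool => Proper2Coloring H c).gcd colorDiff

/-- `hcf(H) = 1` for a bipartite graph `H`: `hcf_c(H) = 1` and `hcf_χ(H) ≤ 2`
(in particular `hcf_χ(H)` is finite, i.e. nonzero in our encoding). -/
def HcfOne [Fintype α] (H : SimpleGraph α) : Prop :=
  hcfC H = 1 ∧ 0 < hcfChi H ∧ hcfChi H ≤ 2

/-- `f` is a copy of `H` inside `G` (an injective graph homomorphism). -/
def IsCopy (H : SimpleGraph α) (G : SimpleGraph β) (f : α → β) : Prop :=
  Function.Injective f ∧ ∀ ⦃a b : α⦄, H.Adj a b → G.Adj (f a) (f b)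

/-- `s` is an `H`-tiling of `G`: a finite collection of pairwise vertex-disjoint copies of `H`. -/
def IsHTiling (H : SimpleGraph α) (G : SimpleGraph β) (s : Finset (α → β)) : Prop :=
  (∀ f ∈ s, IsCopy H G f) ∧
    ∀ f ∈ s, ∀ g ∈ s, f ≠ g → ∀ a b : α, f a ≠ g b

/-- The set of vertices covered by the tiling `s`. -/
noncomputable def coveredSet [Fintype α] [Fintype β] (s : Finset (α → β)) : Finset β :=
  s.biUnion fun f => Finset.univ.image f

/-- `G` has a perfect `H`-tiling (`H`-factor). -/
def HasHFactor [Fintype α] [Fintype β] (H : SimpleGraph α) (G : SimpleGraph β) : Prop :=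
  ∃ s : Finset (α → β), IsHTiling H G s ∧ coveredSet s = Finset.univ

/-- `G` has an `H`-tiling covering all but at most `t` vertices. -/
def HasHTilingMissingAtMost [Fintype α] [Fintype β] (H : SimpleGraph α) (G : SimpleGraph β)
    (t : ℕ) : Prop :=
  ∃ s : Finset (α → β), IsHTiling H G s ∧ (Finset.univ \ coveredSet s).card ≤ t

/-- `G` is a bipartite graph with partition sets `X` and `Y`, written `G[X,Y]`. -/
structure BipartiteWith [Fintype V] (G : SimpleGraph V) (X Y : Finset V) : Prop where
  disj : Disjoint X Y
  cover : X ∪ Y = Finset.univ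
  cross : ∀ ⦃a b : V⦄, G.Adj a b → (a ∈ X ∧ b ∈ Y) ∨ (a ∈ Y ∧ b ∈ X)

/-- `e(A,B)`: the number of edges of `G` between `A` and `B`. -/
noncomputable def eAB (G : SimpleGraph V) (A B : Finset V) : ℕ :=
  ((A ×ˢ B).filter fun p => G.Adj p.1 p.2).card

/-- The density `d(A,B) = e(A,B)/(|A||B|)`. -/
noncomputable def dens (G : SimpleGraph V) (A B : Finset V) : ℝ :=
  (eAB G A B : ℝ) / ((A.card : ℝ) * (B.card : ℝ))

/-- `|Γ(x) ∩ B|`: the number of neighbors of `x` in `B`. -/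
noncomputable def degIn (G : SimpleGraph V) (x : V) (B : Finset V) : ℕ :=
  (B.filter fun y => G.Adj x y).card

/-- The pair `(X,Y)` is `ε`-regular in `G`. -/
def EpsRegularPair (G : SimpleGraph V) (X Y : Finset V) (ε : ℝ) : Prop :=
  ∀ A ⊆ X, ∀ B ⊆ Y, ε * X.card < A.card → ε * Y.card < B.card →
    |dens G A B - dens G X Y| < ε

/-- The pair `(X,Y)` is `(ε,δ)`-super-regular in `G`. -/
def SuperRegularPair (G : SimpleGraph V) (X Y : Finset V) (ε δ : ℝ) : Prop :=
  EpsRegularPair G X Y ε ∧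
    (∀ x ∈ X, δ * Y.card < (degIn G x Y : ℝ)) ∧
    (∀ y ∈ Y, δ * X.card < (degIn G y X : ℝ))

/-- `G[X,Y]` has an almost `(ε,d,p,q,N)`-cover. -/
def HasAlmostCover [Fintype V] (G : SimpleGraph V) (X Y : Finset V) (ε d : ℝ) (p q N : ℕ) :
    Prop :=
  ∃ (X₀ Y₀ : Finset V) (k : ℕ) (P Q : Fin k → Finset V),
    X₀ ⊆ X ∧ Y₀ ⊆ Y ∧
    (X₀.card : ℝ) ≤ ε * X.card ∧ (Y₀.card : ℝ) ≤ ε * Y.card ∧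
    ((X₀ ∪ Y₀) ∪ Finset.univ.biUnion fun i => P i ∪ Q i) = Finset.univ ∧
    (∀ i, Disjoint (X₀ ∪ Y₀) (P i ∪ Q i)) ∧
    (∀ i j, i ≠ j → Disjoint (P i ∪ Q i) (P j ∪ Q j)) ∧
    (∀ i, Disjoint (P i) (Q i)) ∧
    (∀ i, SuperRegularPair G (P i) (Q i) ε d) ∧
    (∀ i, (P i ⊆ X ∧ Q i ⊆ Y) ∨ (P i ⊆ Y ∧ Q i ⊆ X)) ∧
    (∀ i, q * (P i).card = p * (Q i).card ∧ N * p ≤ (P i).card)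

/-- `G[X,Y]` (with `|X| = |Y| = n`) is in the extremal case with parameter `a`:
there are `A ⊆ X`, `B ⊆ Y` with `|A| = |B| = ⌊wn/h⌋` and `d(A,B) ≤ a`. -/
def ExtremalWith [Fintype V] (G : SimpleGraph V) (X Y : Finset V) (w h : ℕ) (a : ℝ) : Prop :=
  ∃ A ⊆ X, ∃ B ⊆ Y, A.card = w * X.card / h ∧ B.card = w * X.card / h ∧ dens G A B ≤ a


/-! ### Vertex sets with an `H`-factor -/

/-- The vertex set `S` of `G` is covered exactly by pairwise disjoint copies of `H`. -/
def Tileable [Fintype α] [Fintype V] (H : SimpleGraph α) (G : SimpleGraph V) (S : Finset V) :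
    Prop :=
  ∃ s : Finset (α → V), IsHTiling H G s ∧ coveredSet s = S

section Tileable

variable [Fintype α] [Fintype V] {H : SimpleGraph α} {G : SimpleGraph V}

theorem tileable_empty : Tileable H G ∅ :=
  ⟨∅, ⟨by simp, by simp⟩, by simp [coveredSet]⟩

theorem Tileable.union {S T : Finset V} (hS : Tileable H G S) (hT : Tileable H G T)
    (hST : Disjoint S T) : Tileable H G (S ∪ T) := by
  obtain ⟨s, ⟨hs1, hs2⟩, rfl⟩ := hS
  obtain ⟨t, ⟨ht1, ht2⟩, rfl⟩ := hT
  have mem : ∀ (s : Finset (α → V)), ∀ f ∈ s, ∀ a, f a ∈ coveredSet s := fun s f hf a =>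
    mem_biUnion.2 ⟨f, hf, mem_image_of_mem _ (mem_univ a)⟩
  refine ⟨s ∪ t, ⟨?_, ?_⟩, ?_⟩
  · intro f hf
    rcases mem_union.1 hf with h | h
    · exact hs1 f h
    · exact ht1 f h
  · intro f hf g hg hfg a b
    rcases mem_union.1 hf with h | h <;> rcases mem_union.1 hg with h' | h'
    · exact hs2 f h g h' hfg a b
    · exact disjoint_iff_ne.1 hST _ (mem s f h a) _ (mem t g h' b)
    · exact (disjoint_iff_ne.1 hST _ (mem s g h' b) _ (mem t f h a)).symm
    · exact ht2 f h g h' hfg a b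
  · exact Finset.union_biUnion

theorem IsCopy.tileable {f : α → V} (hf : IsCopy H G f) : Tileable H G (univ.image f) :=
  ⟨{f}, ⟨by simpa using hf, by simp⟩, by simp [coveredSet]⟩

theorem Tileable.dvd_card {S : Finset V} (hS : Tileable H G S) : Fintype.card α ∣ S.card := by
  obtain ⟨s, ⟨hs1, hs2⟩, rfl⟩ := hS
  rw [coveredSet, card_biUnion]
  · refine dvd_sum fun f hf => ?_
    rw [card_image_of_injective _ (hs1 f hf).1, card_univ]
  · intro f hf g hg hfg
    rw [Function.onFun, disjoint_left]
    rintro x hx hx'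
    obtain ⟨a, -, rfl⟩ := mem_image.1 hx
    obtain ⟨b, -, hb⟩ := mem_image.1 hx'
    exact hs2 f hf g hg hfg a b hb.symm

end Tileable

/-! ### Counting complete bipartite configurations -/

theorem card_mul_avg_pow_le {ι : Type*} (s : Finset ι) (f : ι → ℝ) (hf : ∀ i ∈ s, 0 ≤ f i)
    {c : ℝ} (hc : 0 ≤ c) (h : c * s.card ≤ ∑ i ∈ s, f i) (n : ℕ) :
    s.card * c ^ n ≤ ∑ i ∈ s, f i ^ n := by
  rcases s.eq_empty_or_nonempty with rfl | hs
  · simp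
  have hpos : (0 : ℝ) < s.card := by exact_mod_cast hs.card_pos
  have := Real.pow_arith_mean_le_arith_mean_pow s (fun _ => (s.card : ℝ)⁻¹) f
    (fun _ _ => by positivity) (by simp [hpos.ne']) hf n
  rw [← mul_sum, ← mul_sum] at this
  have h2 : c ≤ (s.card : ℝ)⁻¹ * ∑ i ∈ s, f i := by
    rw [inv_mul_eq_div, le_div_iff₀ hpos]; exact h
  calc s.card * c ^ n ≤ s.card * ((s.card : ℝ)⁻¹ * ∑ i ∈ s, f i) ^ n := by gcongr
    _ ≤ s.card * ((s.card : ℝ)⁻¹ * ∑ i ∈ s, f i ^ n) := by gcongr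
    _ = _ := by field_simp

/-- The pairs of tuples in `A` and `B` spanning a complete bipartite graph. -/
noncomputable def completePairs [Fintype V] (G : SimpleGraph V) (A B : Finset V)
    (ι κ : Type*) [Fintype ι] [Fintype κ] : Finset ((ι → V) × (κ → V)) :=
  univ.filter fun p => (∀ i, p.1 i ∈ A) ∧ (∀ j, p.2 j ∈ B) ∧ ∀ i j, G.Adj (p.1 i) (p.2 j)

theorem eAB_eq_sum_degIn (G : SimpleGraph V) (A B : Finset V) :
    eAB G A B = ∑ x ∈ A, degIn G x B := by
  simp only [eAB, degIn, card_filter, sum_product]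

theorem eAB_comm (G : SimpleGraph V) (A B : Finset V) : eAB G A B = eAB G B A := by
  simp only [eAB, card_filter, sum_product]
  rw [sum_comm]
  simp only [G.adj_comm]

theorem le_card_completePairs [Fintype V] (G : SimpleGraph V) (A B : Finset V)
    (ι κ : Type*) [Fintype ι] [Fintype κ] {d : ℝ} (hd : 0 ≤ d)
    (h : d * (A.card * B.card) ≤ eAB G A B) :
    d ^ (Fintype.card ι * Fintype.card κ) * (A.card ^ Fintype.card ι * B.card ^ Fintype.card κ) ≤
      ((completePairs G A B ι κ).card : ℝ) := by
  set P : Finset (ι → V) := Fintype.piFinset fun _ => A with hP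
  set cod : (ι → V) → Finset V := fun x => B.filter fun y => ∀ i, G.Adj (x i) y with hcod
  have hPc : (P.card : ℝ) = A.card ^ Fintype.card ι := by
    simp [hP, Fintype.card_piFinset]
  have hcount : ((completePairs G A B ι κ).card : ℝ) =
      ∑ x ∈ P, ((cod x).card : ℝ) ^ Fintype.card κ := by
    have : (completePairs G A B ι κ).card =
        ∑ x ∈ P, (Fintype.piFinset fun _ : κ => cod x).card := by
      rw [← card_sigma]
      refine card_bij' (fun p _ => ⟨p.1, p.2⟩) (fun p _ => (p.1, p.2)) ?_ ?_ ?_ ?_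
      · intro p hp
        simp only [completePairs, mem_filter, mem_univ, true_and] at hp
        simp only [mem_sigma, hP, Fintype.mem_piFinset, hcod, mem_filter]
        exact ⟨hp.1, fun j => ⟨hp.2.1 j, fun i => hp.2.2 i j⟩⟩
      · intro p hp
        simp only [mem_sigma, hP, Fintype.mem_piFinset, hcod, mem_filter] at hp
        simp only [completePairs, mem_filter, mem_univ, true_and]
        exact ⟨hp.1, fun j => (hp.2 j).1, fun i j => (hp.2 j).2 i⟩
      · intro p _; rfl
      · intro p _; rfl
    rw [this]; push_cast
    refine sum_congr rfl fun x _ => ?_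
    simp [Fintype.card_piFinset]
  have hsum : ∑ x ∈ P, ((cod x).card : ℝ) = ∑ y ∈ B, (degIn G y A : ℝ) ^ Fintype.card ι := by
    have h1 : ∀ y ∈ B, ((degIn G y A : ℝ)) ^ Fintype.card ι =
        ((Fintype.piFinset fun _ : ι => A.filter fun x => G.Adj y x).card : ℝ) := by
      intro y _; simp [Fintype.card_piFinset, degIn]
    rw [sum_congr rfl h1]
    have h2 : ∑ x ∈ P, (cod x).card =
        ∑ y ∈ B, (Fintype.piFinset fun _ : ι => A.filter fun x => G.Adj y x).card := by
      refine (sum_card_bipartiteAbove_eq_sum_card_bipartiteBelow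
        (s := P) (t := B) (fun (x : ι → V) y => ∀ i, G.Adj (x i) y)).trans ?_
      refine sum_congr rfl fun y _ => ?_
      congr 1
      ext x
      simp only [bipartiteBelow, mem_filter, hP, Fintype.mem_piFinset]
      constructor
      · rintro ⟨h1, h2⟩ i; exact ⟨h1 i, (h2 i).symm⟩
      · intro h; exact ⟨fun i => (h i).1, fun i => (h i).2.symm⟩
    exact_mod_cast h2
  have hdeg : (d * A.card) * B.card ≤ ∑ y ∈ B, (degIn G y A : ℝ) := by
    rw [eAB_comm, eAB_eq_sum_degIn] at h
    push_cast at h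
    linarith
  have s1 := card_mul_avg_pow_le B (fun y => (degIn G y A : ℝ)) (fun _ _ => by positivity)
    (by positivity) hdeg (Fintype.card ι)
  rw [← hsum] at s1
  have s2 := card_mul_avg_pow_le P (fun x => ((cod x).card : ℝ)) (fun _ _ => by positivity)
    (c := d ^ Fintype.card ι * B.card) (by positivity) (by
      rw [hPc]; calc _ = B.card * (d * A.card) ^ Fintype.card ι := by ring
        _ ≤ _ := s1) (Fintype.card κ)
  rw [hcount]
  refine le_trans (le_of_eq ?_) s2
  rw [hPc, pow_mul]; ring


/-! ### Vectors of class sizes realized by copies of `H` in a union of complete bipartite graphs -/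

section Realizable

variable {I : Type*}

/-- `φ` maps edges of `H` to edges of the perfect matching on `I × Bool` joining `(i, true)` to
`(i, false)`. -/
def IsMatchingHom (H : SimpleGraph α) (φ : α → I × Bool) : Prop :=
  ∀ ⦃a b : α⦄, H.Adj a b → (φ a).1 = (φ b).1 ∧ (φ a).2 ≠ (φ b).2

theorem isMatchingHom_mk {H : SimpleGraph α} {c : α → Bool} (hc : Proper2Coloring H c) (i : I) :
    IsMatchingHom H fun a => (i, c a) :=
  fun _ _ hab => ⟨rfl, hc hab⟩

theorem isMatchingHom_mk_not {H : SimpleGraph α} {c : α → Bool} (hc : Proper2Coloring H c) (i : I) :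
    IsMatchingHom H fun a => (i, !c a) :=
  fun _ _ hab => ⟨rfl, by simpa using hc hab⟩

theorem sum_sign_eq (c : α → Bool) (s : Finset α) : ∑ a ∈ s, (if c a then (1 : ℤ) else -1) =
    ((s.filter fun a => c a = true).card : ℤ) - (s.filter fun a => c a = false).card := by
  have h : ∀ a, (if c a then (1 : ℤ) else -1) =
      (if c a = true then 1 else 0) - (if c a = false then 1 else 0) := by
    intro a; cases c a <;> simp
  simp only [h, sum_sub_distrib, card_filter]
  push_cast; rfl

variable [Fintype α]

/-- The class sizes of unions of blown-up copies of `H` in the matching on `I × Bool`. -/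
noncomputable def realizable (H : SimpleGraph α) (I : Type*) : AddSubmonoid (I × Bool → ℕ) :=
  AddSubmonoid.closure {v | ∃ φ : α → I × Bool, IsMatchingHom H φ ∧
    v = fun j => (univ.filter fun a => φ a = j).card}

/-- The group of differences of realizable vectors. -/
noncomputable def realizableDiff (H : SimpleGraph α) (I : Type*) :
    AddSubgroup (I × Bool → ℤ) where
  carrier := {z | ∃ p ∈ realizable H I, ∃ q ∈ realizable H I, ∀ j, z j = (p j : ℤ) - q j}
  zero_mem' := ⟨0, zero_mem _, 0, zero_mem _, by simp⟩
  add_mem' := by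
    rintro x y ⟨p, hp, q, hq, h⟩ ⟨p', hp', q', hq', h'⟩
    refine ⟨p + p', add_mem hp hp', q + q', add_mem hq hq', fun j => ?_⟩
    simp only [Pi.add_apply, h, h']; push_cast; ring
  neg_mem' := by
    rintro x ⟨p, hp, q, hq, h⟩
    refine ⟨q, hq, p, hp, fun j => ?_⟩
    simp only [Pi.neg_apply, h]; ring

theorem gcd_nsmul_mem {A ι : Type*} [AddCommGroup A] (S : AddSubgroup A) (x : A) (s : Finset ι)
    (f : ι → ℕ) (h : ∀ i ∈ s, f i • x ∈ S) : s.gcd f • x ∈ S := by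
  induction s using Finset.induction_on with
  | empty => simp
  | insert i s hi ih =>
    rw [gcd_insert]
    have h1 := h i (mem_insert_self _ _)
    have h2 := ih fun j hj => h j (mem_insert_of_mem hj)
    rw [← natCast_zsmul] at h1 h2 ⊢
    have : ((GCDMonoid.gcd (f i) (s.gcd f) : ℕ) : ℤ) =
        (f i : ℤ) * Nat.gcdA (f i) (s.gcd f) + ((s.gcd f : ℕ) : ℤ) * Nat.gcdB (f i) (s.gcd f) :=
      Nat.gcd_eq_gcd_ab _ _
    rw [this, add_smul, mul_comm, mul_smul, mul_comm, mul_smul]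
    exact add_mem (S.zsmul_mem h1 _) (S.zsmul_mem h2 _)

/-- The basis vector of the class `j`. -/
noncomputable def classVec (j : I × Bool) : I × Bool → ℤ := Pi.single j 1

theorem sum_classVec_apply (φ : α → I × Bool) (j : I × Bool) :
    (∑ a, classVec (φ a)) j = ((univ.filter fun a => φ a = j).card : ℤ) := by
  simp only [classVec, Finset.sum_apply, Pi.single_apply, card_filter, eq_comm]
  push_cast; rfl

variable {H : SimpleGraph α}

theorem card_fiber_mem_realizable {φ : α → I × Bool} (hφ : IsMatchingHom H φ) :
    (fun j => (univ.filter fun a => φ a = j).card) ∈ realizable H I :=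
  AddSubmonoid.subset_closure ⟨φ, hφ, rfl⟩

theorem sum_classVec_mem {φ : α → I × Bool} (hφ : IsMatchingHom H φ) :
    ∑ a, classVec (φ a) ∈ realizableDiff H I :=
  ⟨_, card_fiber_mem_realizable hφ, 0, zero_mem _, fun j => by rw [sum_classVec_apply]; simp⟩

theorem sum_comp_classVec_sub_mem {φ φ' : α → I × Bool} (hφ : IsMatchingHom H φ)
    (hφ' : IsMatchingHom H φ') (K : H.ConnectedComponent) :
    ∑ a with H.connectedComponentMk a = K, (classVec (φ a) - classVec (φ' a)) ∈
      realizableDiff H I := by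
  set ψ : α → I × Bool := fun a => if H.connectedComponentMk a = K then φ a else φ' a with hψ
  have hψh : IsMatchingHom H ψ := by
    intro a b hab
    have : H.connectedComponentMk a = H.connectedComponentMk b :=
      SimpleGraph.ConnectedComponent.sound hab.reachable
    simp only [hψ, this]
    split_ifs
    · exact hφ hab
    · exact hφ' hab
  have := sub_mem (sum_classVec_mem hψh) (sum_classVec_mem hφ')
  rw [← sum_sub_distrib] at this
  rw [sum_filter]
  convert this using 2 with a
  simp only [hψ]; split_ifs <;> simp

theorem classVec_sub_not (i : I) (b : Bool) : classVec (i, b) - classVec (i, !b) =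
    (if b then (1 : ℤ) else -1) • (classVec (i, true) - classVec (i, false)) := by
  cases b <;> simp

theorem colorDiff_nsmul_mem {c : α → Bool} (hc : Proper2Coloring H c) (i : I) :
    colorDiff c • (classVec (i, true) - classVec (i, false)) ∈ realizableDiff H I := by
  have := sub_mem (sum_classVec_mem (isMatchingHom_mk hc i))
    (sum_classVec_mem (isMatchingHom_mk_not hc i))
  rw [← sum_sub_distrib] at this
  simp only [classVec_sub_not i (c _)] at this
  rw [← sum_smul, sum_sign_eq] at this
  rw [← natCast_zsmul, colorDiff, Int.natCast_natAbs]
  rcases abs_choice ((colorCard c true : ℤ) - colorCard c false) with h | h <;> rw [h]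
  · exact this
  · rw [neg_smul]; exact neg_mem this

theorem classVec_true_sub_false_mem (hbip : IsBip H) (hhcf : HcfOne H) (i : I) :
    classVec (i, true) - classVec (i, false) ∈ realizableDiff H I := by
  set x := classVec (i, true) - classVec (i, false) with hx
  obtain ⟨hc1, hpos, hle⟩ := hhcf
  have h2 : (2 : ℤ) • x ∈ realizableDiff H I := by
    have := gcd_nsmul_mem (realizableDiff H I) x
      (univ.filter fun c : α → Bool => Proper2Coloring H c) colorDiff
      fun c hc => colorDiff_nsmul_mem (mem_filter.1 hc).2 i
    change hcfChi H • x ∈ _ at this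
    interval_cases h : hcfChi H
    · rw [one_smul] at this; exact zsmul_mem this 2
    · rw [← natCast_zsmul] at this; exact_mod_cast this
  obtain ⟨c, hc⟩ := hbip
  obtain ⟨K, hK⟩ : ∃ K : H.ConnectedComponent, Odd (compCard H K) := by
    by_contra! hcon
    have : 2 ∣ hcfC H := dvd_gcd fun K _ => (Nat.not_odd_iff_even.1 (hcon K)).two_dvd
    rw [hc1] at this; omega
  have h3 := sum_comp_classVec_sub_mem (isMatchingHom_mk hc i) (isMatchingHom_mk_not hc i) K
  simp only [classVec_sub_not i (c _)] at h3
  rw [← sum_smul, sum_sign_eq] at h3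
  have hcard := card_filter_add_card_filter_not
    (s := univ.filter fun a => H.connectedComponentMk a = K) (fun a => c a = true)
  simp only [Bool.not_eq_true] at hcard
  change _ = compCard H K at hcard
  obtain ⟨k, hk⟩ := hK
  generalize (((univ.filter fun a => H.connectedComponentMk a = K).filter
    fun a => c a = true).card) = A at h3 hcard
  generalize (((univ.filter fun a => H.connectedComponentMk a = K).filter
    fun a => c a = false).card) = B at h3 hcard
  have : x = ((A : ℤ) - B) • x + ((B : ℤ) - k) • ((2 : ℤ) • x) := by
    rw [smul_smul, ← add_smul]
    have : (A : ℤ) - B + (B - k) * 2 = 1 := by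
      have : (A : ℤ) + B = 2 * k + 1 := by exact_mod_cast hcard.trans hk
      linarith
    rw [this, one_smul]
  rw [this]
  exact add_mem h3 (zsmul_mem h2 _)

theorem classVec_false_sub_mem (hbip : IsBip H) (hhcf : HcfOne H) (i i' : I) :
    classVec (i, false) - classVec (i', false) ∈ realizableDiff H I := by
  set y := classVec (i, false) - classVec (i', false) with hy
  have hgcd := gcd_nsmul_mem (realizableDiff H I) y (comps H) (compCard H) ?_
  · change hcfC H • y ∈ _ at hgcd
    rwa [hhcf.1, one_smul] at hgcd
  intro K _
  have hx := classVec_true_sub_false_mem hbip hhcf i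
  have hx' := classVec_true_sub_false_mem hbip hhcf i'
  obtain ⟨c, hc⟩ := hbip
  have h3 := sum_comp_classVec_sub_mem (isMatchingHom_mk hc i) (isMatchingHom_mk hc i') K
  have h4 : ∀ a, y - (classVec (i, c a) - classVec (i', c a)) ∈ realizableDiff H I := by
    intro a
    cases c a
    · simp [hy]
    · have := sub_mem hx' hx
      convert this using 1
      rw [hy]; abel
  have h5 : ∑ a with H.connectedComponentMk a = K,
      (y - (classVec (i, c a) - classVec (i', c a))) ∈ realizableDiff H I :=
    sum_mem fun a _ => h4 a
  rw [sum_sub_distrib, sum_const] at h5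
  have := add_mem h5 h3
  rwa [sub_add_cancel] at this

/-- There is a realizable vector that stays realizable when the class `(a, false)` is enlarged by
one for every `a`. -/
theorem exists_realizable_add_one (hbip : IsBip H) (hhcf : HcfOne H) [Nonempty α] :
    ∃ q ∈ realizable H α, (∃ j, q j ≠ 0) ∧
      (fun j => q j + if j.2 = false then 1 else 0) ∈ realizable H α := by
  have i0 : α := Classical.arbitrary α
  have key : ∑ a : α, classVec (a, false) ∈ realizableDiff H α := by
    obtain ⟨c, hc⟩ := id hbip
    have h1 : ∀ a, classVec (a, false) - classVec (i0, c a) ∈ realizableDiff H α := by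
      intro a
      have h := classVec_false_sub_mem hbip hhcf a i0
      cases c a
      · exact h
      · have := sub_mem h (classVec_true_sub_false_mem hbip hhcf i0)
        convert this using 1; abel
    have h2 := sum_mem (S := realizableDiff H α) fun a (_ : a ∈ univ) => h1 a
    rw [sum_sub_distrib] at h2
    have := add_mem h2 (sum_classVec_mem (isMatchingHom_mk hc i0))
    rwa [sub_add_cancel] at this
  obtain ⟨c, hc⟩ := hbip
  obtain ⟨p, hp, q, hq, h⟩ := key
  have hv := card_fiber_mem_realizable (isMatchingHom_mk hc i0)
  refine ⟨_, add_mem hq hv, ⟨(i0, c i0), ?_⟩, ?_⟩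
  · have : 0 < (univ.filter fun a => (i0, c a) = (i0, c i0)).card :=
      card_pos.2 ⟨i0, by simp⟩
    simp only [Pi.add_apply]
    omega
  · convert add_mem hp hv using 1
    ext j
    have hj := h j
    have : (∑ a : α, classVec (a, false)) j = if j.2 = false then 1 else 0 := by
      simp only [classVec, Finset.sum_apply, Pi.single_apply]
      obtain ⟨j1, j2⟩ := j
      cases j2 <;> simp
    rw [this] at hj
    simp only [Pi.add_apply]
    split_ifs at hj ⊢ <;> omega

end Realizable

/-! ### Absorbing tuples -/

section AbsorbingTuples

variable [Fintype α] [Fintype V] {H : SimpleGraph α} {G : SimpleGraph V}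

theorem tileable_of_realizable {I : Type*} [Fintype I] {v : I × Bool → ℕ}
    (hv : v ∈ realizable H I) : ∀ Z : I × Bool → Finset V, (∀ j, (Z j).card = v j) →
      (∀ j j', j ≠ j' → Disjoint (Z j) (Z j')) →
      (∀ i, ∀ x ∈ Z (i, false), ∀ y ∈ Z (i, true), G.Adj x y) →
      Tileable H G (univ.biUnion Z) := by
  induction hv using AddSubmonoid.closure_induction with
  | zero =>
    intro Z hZ _ _
    have : univ.biUnion Z = ∅ := by
      ext x; simp only [mem_biUnion, mem_univ, true_and, notMem_empty, iff_false, not_exists]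
      intro j; rw [card_eq_zero.1 (hZ j)]; simp
    rw [this]; exact tileable_empty
  | add p q _ _ ihp ihq =>
    intro Z hZ hd hadj
    have : ∀ j, ∃ Z' ⊆ Z j, Z'.card = p j := fun j =>
      exists_subset_card_eq (by rw [hZ]; simp)
    choose Z' hZ' hc using this
    have h1 := ihp Z' hc (fun j j' h => (hd j j' h).mono (hZ' _) (hZ' _))
      fun i x hx y hy => hadj i x (hZ' _ hx) y (hZ' _ hy)
    have h2 := ihq (fun j => Z j \ Z' j)
      (fun j => by rw [card_sdiff_of_subset (hZ' j), hZ, hc]; simp)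
      (fun j j' h => (hd j j' h).mono sdiff_subset sdiff_subset)
      fun i x hx y hy => hadj i x (sdiff_subset hx) y (sdiff_subset hy)
    have h3 := h1.union h2 (by
      rw [disjoint_biUnion_left]
      intro j _
      rw [disjoint_biUnion_right]
      intro j' _
      by_cases h : j = j'
      · subst h; exact disjoint_sdiff
      · exact (hd j j' h).mono (hZ' _) sdiff_subset)
    convert h3 using 1
    ext x
    simp only [mem_biUnion, mem_univ, true_and, mem_union, mem_sdiff]
    constructor
    · rintro ⟨j, hj⟩
      by_cases hx : x ∈ Z' j
      · exact Or.inl ⟨j, hx⟩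
      · exact Or.inr ⟨j, hj, hx⟩
    · rintro (⟨j, hj⟩ | ⟨j, hj, -⟩)
      · exact ⟨j, hZ' j hj⟩
      · exact ⟨j, hj⟩
  | mem v hv =>
    obtain ⟨φ, hφ, rfl⟩ := hv
    intro Z hZ hd hadj
    have e : ∀ j, {a // φ a = j} ≃ {x // x ∈ Z j} := fun j => Classical.choice <| by
      rw [← Fintype.card_eq, Fintype.card_subtype, Fintype.card_coe, hZ]
    set f : α → V := fun a => (e (φ a) ⟨a, rfl⟩ : V) with hf
    have hfZ : ∀ a, f a ∈ Z (φ a) := fun a => (e (φ a) ⟨a, rfl⟩).2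
    have hfe : ∀ a j (h : φ a = j), f a = e j ⟨a, h⟩ := by rintro a j rfl; rfl
    have hcopy : IsCopy H G f := by
      refine ⟨fun a b hab => ?_, fun a b hab => ?_⟩
      · have h : φ a = φ b := by
          by_contra h
          exact disjoint_left.1 (hd _ _ h) (hfZ a) (hab ▸ hfZ b)
        rw [hfe a _ h, hfe b _ rfl] at hab
        simpa using (e _).injective (Subtype.ext hab)
      · obtain ⟨h1, h2⟩ := hφ hab
        have ha := hfZ a
        have hb := hfZ b
        generalize φ a = j at *
        generalize φ b = j' at *
        obtain ⟨i, c⟩ := j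
        obtain ⟨i', c'⟩ := j'
        simp only at h1 h2
        subst h1
        cases c <;> cases c'
        · exact absurd rfl h2
        · exact hadj i _ ha _ hb
        · exact (hadj i _ hb _ ha).symm
        · exact absurd rfl h2
    convert hcopy.tileable using 1
    ext x
    simp only [mem_biUnion, mem_univ, true_and, mem_image]
    constructor
    · rintro ⟨j, hj⟩
      refine ⟨((e j).symm ⟨x, hj⟩ : α), ?_⟩
      rw [hfe _ j ((e j).symm ⟨x, hj⟩).2]
      simp
    · rintro ⟨a, rfl⟩
      exact ⟨_, hfZ a⟩

/-- The adjacency pattern of an absorbing tuple for `t`. -/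
def AbsorbingPattern (G : SimpleGraph V) (q : α × Bool → ℕ) (t : α → V)
    (S : (Σ j, Fin (q j)) → V) : Prop :=
  ∀ i l, G.Adj (t i) (S ⟨(i, true), l⟩) ∧ ∀ k, G.Adj (S ⟨(i, false), k⟩) (S ⟨(i, true), l⟩)

/-- The absorbing tuples for `t`. -/
noncomputable def absorbingTuples (G : SimpleGraph V) (q : α × Bool → ℕ) (t : α → V) :
    Finset ((Σ j, Fin (q j)) → V) :=
  univ.filter fun S => AbsorbingPattern G q t S ∧ Function.Injective S ∧ ∀ e a, S e ≠ t a

theorem tileable_of_mem_absorbingTuples {q : α × Bool → ℕ} {t : α → V}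
    {S : (Σ j, Fin (q j)) → V} (hS : S ∈ absorbingTuples G q t) (hq : q ∈ realizable H α) :
    Tileable H G (univ.image S) := by
  obtain ⟨hpat, hinj, -⟩ := (mem_filter.1 hS).2
  have := tileable_of_realizable (G := G) hq (fun j => univ.image fun k => S ⟨j, k⟩) ?_ ?_ ?_
  · convert this using 1
    ext x
    simp
  · intro j
    rw [card_image_of_injective, card_univ, Fintype.card_fin]
    intro k k' h
    simpa using hinj h
  · intro j j' h
    rw [disjoint_left]
    simp only [mem_image, mem_univ, true_and]
    rintro x ⟨k, rfl⟩ ⟨k', h'⟩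
    have := congrArg Sigma.fst (hinj h')
    exact h this.symm
  · simp only [mem_image, mem_univ, true_and]
    rintro i x ⟨k, rfl⟩ y ⟨l, rfl⟩
    exact (hpat i l).2 k

theorem tileable_union_of_mem_absorbingTuples {q : α × Bool → ℕ} {t : α → V}
    (ht : Function.Injective t) {S : (Σ j, Fin (q j)) → V} (hS : S ∈ absorbingTuples G q t)
    (hq : (fun j => q j + if j.2 = false then 1 else 0) ∈ realizable H α) :
    Tileable H G (univ.image S ∪ univ.image t) := by
  obtain ⟨hpat, hinj, hdis⟩ := (mem_filter.1 hS).2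
  have hmem : ∀ (j : α × Bool) (x : V), (x ∈ if j.2 = false then ({t j.1} : Finset V) else ∅) ↔
      j.2 = false ∧ x = t j.1 := by
    intro j x; split_ifs with h <;> simp [h]
  have := tileable_of_realizable (G := G) hq
    (fun j => (univ.image fun k => S ⟨j, k⟩) ∪ if j.2 = false then {t j.1} else ∅) ?_ ?_ ?_
  · convert this using 1
    ext x
    simp only [mem_union, mem_biUnion, hmem, mem_image, mem_univ, true_and, Sigma.exists,
      Prod.exists]
    constructor
    · rintro (⟨i, b, k, rfl⟩ | ⟨a, rfl⟩)
      · exact ⟨i, b, Or.inl ⟨k, rfl⟩⟩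
      · exact ⟨a, false, Or.inr ⟨rfl, rfl⟩⟩
    · rintro ⟨i, b, ⟨k, rfl⟩ | ⟨rfl, rfl⟩⟩
      · exact Or.inl ⟨i, b, k, rfl⟩
      · exact Or.inr ⟨i, rfl⟩
  · intro j
    rw [card_union_of_disjoint, card_image_of_injective, card_univ, Fintype.card_fin]
    · split_ifs <;> simp
    · intro k k' h
      simpa using hinj h
    · rw [disjoint_left]
      intro x hx hx'
      rw [hmem] at hx'
      obtain ⟨k, -, rfl⟩ := mem_image.1 hx
      exact hdis _ _ hx'.2
  · intro j j' h
    rw [disjoint_left]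
    simp only [mem_image, mem_univ, true_and, mem_union, hmem]
    rintro x (⟨k, rfl⟩ | ⟨hj, rfl⟩) (⟨k', h'⟩ | ⟨hj', h'⟩)
    · exact h (congrArg Sigma.fst (hinj h')).symm
    · exact hdis _ _ h'
    · exact hdis _ _ h'
    · exact h (Prod.ext (ht h') (hj.trans hj'.symm))
  · intro i x hx y hy
    rw [mem_union, hmem, mem_image] at hx hy
    obtain ⟨k, -, rfl⟩ | ⟨-, rfl⟩ := hx <;> obtain ⟨l, -, rfl⟩ | ⟨h, -⟩ := hy
    · exact (hpat i l).2 k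
    · simp at h
    · exact (hpat i l).1
    · simp at h

theorem card_mul_card_filter_eq_le {E : Type*} [Fintype E] (e : E) (g : (E → V) → V)
    (hg : ∀ S v, g (Function.update S e v) = g S) :
    Fintype.card V * (univ.filter fun S : E → V => S e = g S).card ≤
      Fintype.card V ^ Fintype.card E := by
  rw [← card_univ (α := V), ← card_product]
  calc _ ≤ (univ : Finset (E → V)).card := ?_
    _ = _ := by simp
  refine card_le_card_of_injOn (fun p => Function.update p.2 e p.1) (fun _ _ => mem_univ _) ?_
  rintro ⟨v, S⟩ hS ⟨v', S'⟩ hS' h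
  simp only [coe_product, Set.mem_prod, mem_coe, mem_filter, mem_univ, true_and] at hS hS'
  simp only at h
  have hv : v = v' := by simpa using congrFun h e
  have h1 : g S = g S' := by rw [← hg S v, h, hg]
  refine Prod.ext hv ?_
  ext x
  by_cases hx : x = e
  · subst hx; show S x = S' x; rw [hS, hS', h1]
  · simpa [hx] using congrFun h x

theorem le_card_pattern (q : α × Bool → ℕ) (t : α → V) {c : ℝ} (hc : 0 ≤ c)
    (hdeg : ∀ v, c * Fintype.card V ≤ G.degree v) :
    c ^ (∑ i, (q (i, false) * q (i, true) + q (i, true))) *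
      (Fintype.card V : ℝ) ^ (Fintype.card (Σ j, Fin (q j))) ≤
      ((univ.filter fun S => AbsorbingPattern G q t S).card : ℝ) := by
  set P : Finset ((i : α) → (Fin (q (i, false)) → V) × (Fin (q (i, true)) → V)) :=
    Fintype.piFinset fun i => completePairs G univ (G.neighborFinset (t i))
      (Fin (q (i, false))) (Fin (q (i, true))) with hP
  have h1 : P.card ≤ (univ.filter fun S => AbsorbingPattern G q t S).card := by
    refine card_le_card_of_injOn
      (fun f s => match s with
        | ⟨(i, false), k⟩ => (f i).1 k
        | ⟨(i, true), k⟩ => (f i).2 k) ?_ ?_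
    · intro f hf
      simp only [hP, mem_coe, Fintype.mem_piFinset, completePairs, mem_filter, mem_univ,
        true_and, SimpleGraph.mem_neighborFinset] at hf
      simp only [mem_coe, mem_filter, mem_univ, true_and]
      exact fun i l => ⟨(hf i).2.1 l, fun k => (hf i).2.2 k l⟩
    · intro f _ f' _ h
      funext i
      refine Prod.ext ?_ ?_
      · funext k; exact congrFun h ⟨(i, false), k⟩
      · funext k; exact congrFun h ⟨(i, true), k⟩
  have h2 : ∀ i, c ^ (q (i, false) * q (i, true) + q (i, true)) *
      (Fintype.card V : ℝ) ^ (q (i, false) + q (i, true)) ≤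
      ((completePairs G univ (G.neighborFinset (t i))
      (Fin (q (i, false))) (Fin (q (i, true)))).card : ℝ) := by
    intro i
    have := le_card_completePairs G univ (G.neighborFinset (t i)) (Fin (q (i, false)))
      (Fin (q (i, true))) hc (by
        rw [eAB_comm, eAB_eq_sum_degIn]
        push_cast
        calc c * ((univ : Finset V).card * ((G.neighborFinset (t i)).card : ℝ)) =
            ∑ x ∈ G.neighborFinset (t i), c * Fintype.card V := by
              rw [sum_const, card_univ, nsmul_eq_mul]; ring
          _ ≤ _ := sum_le_sum fun x _ => by
              refine (hdeg x).trans (le_of_eq ?_)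
              rw [degIn, ← G.card_neighborFinset_eq_degree, G.neighborFinset_eq_filter])
    refine le_trans ?_ this
    simp only [Fintype.card_fin, card_univ, G.card_neighborFinset_eq_degree]
    calc _ = c ^ (q (i, false) * q (i, true)) * ((Fintype.card V : ℝ) ^ (q (i, false)) *
          (c * Fintype.card V) ^ (q (i, true))) := by rw [pow_add, pow_add, mul_pow]; ring
      _ ≤ _ := by gcongr; exact hdeg _
  calc _ = ∏ i, (c ^ (q (i, false) * q (i, true) + q (i, true)) *
      (Fintype.card V : ℝ) ^ (q (i, false) + q (i, true))) := by
        rw [prod_mul_distrib, prod_pow_eq_pow_sum, prod_pow_eq_pow_sum, Fintype.card_sigma,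
          Fintype.sum_prod_type]
        simp [add_comm]
    _ ≤ ∏ i, ((completePairs G univ (G.neighborFinset (t i))
      (Fin (q (i, false))) (Fin (q (i, true)))).card : ℝ) :=
        prod_le_prod (fun i _ => by positivity) fun i _ => h2 i
    _ = (P.card : ℝ) := by rw [hP, Fintype.card_piFinset]; push_cast; rfl
    _ ≤ _ := by exact_mod_cast h1

theorem card_mul_card_filter_le {E : Type*} [Fintype E] (t : α → V) (P : (E → V) → Prop) :
    Fintype.card V * (univ.filter fun S => P S).card ≤
      Fintype.card V * (univ.filter fun S : E → V => P S ∧ Function.Injective S ∧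
        ∀ e a, S e ≠ t a).card +
        (Fintype.card E ^ 2 + Fintype.card E * Fintype.card α) *
          Fintype.card V ^ Fintype.card E := by
  set N := Fintype.card V
  set B1 : Finset (E → V) := (univ : Finset E).offDiag.biUnion fun e =>
    univ.filter fun S : E → V => S e.1 = S e.2 with hB1
  set B2 : Finset (E → V) := (univ : Finset (E × α)).biUnion fun e =>
    univ.filter fun S : E → V => S e.1 = t e.2 with hB2
  have hsub : (univ.filter fun S => P S) ⊆
      (univ.filter fun S : E → V => P S ∧ Function.Injective S ∧
        ∀ e a, S e ≠ t a) ∪ (B1 ∪ B2) := by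
    intro S hS
    simp only [mem_filter, mem_univ, true_and] at hS
    by_contra hcon
    simp only [mem_union, not_or, mem_filter, mem_univ, true_and, hS, hB1, hB2,
      mem_biUnion, not_exists, not_and, mem_offDiag, Prod.forall] at hcon
    obtain ⟨h1, h2, h3⟩ := hcon
    refine h1 ?_ h3
    intro e e' h
    by_contra hne
    exact h2 e e' hne h
  have h1 : N * B1.card ≤ Fintype.card E ^ 2 * N ^ Fintype.card E := by
    calc N * B1.card ≤ N * ∑ e ∈ (univ : Finset E).offDiag,
          (univ.filter fun S : E → V => S e.1 = S e.2).card :=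
            Nat.mul_le_mul_left _ card_biUnion_le
      _ = ∑ e ∈ (univ : Finset E).offDiag,
          N * (univ.filter fun S : E → V => S e.1 = S e.2).card := mul_sum _ _ _
      _ ≤ ∑ e ∈ (univ : Finset E).offDiag, N ^ Fintype.card E := by
          refine sum_le_sum fun e he => card_mul_card_filter_eq_le e.1 (fun S => S e.2) ?_
          intro S v
          exact Function.update_of_ne (mem_offDiag.1 he).2.2.symm _ _
      _ ≤ _ := by
          rw [sum_const, smul_eq_mul, offDiag_card, card_univ, sq]
          exact Nat.mul_le_mul_right _ (Nat.sub_le _ _)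
  have h2 : N * B2.card ≤ Fintype.card E * Fintype.card α * N ^ Fintype.card E := by
    calc N * B2.card ≤ N * ∑ e : E × α,
          (univ.filter fun S : E → V => S e.1 = t e.2).card :=
            Nat.mul_le_mul_left _ card_biUnion_le
      _ = ∑ e : E × α,
          N * (univ.filter fun S : E → V => S e.1 = t e.2).card := mul_sum _ _ _
      _ ≤ ∑ e : E × α, N ^ Fintype.card E :=
          sum_le_sum fun e _ => card_mul_card_filter_eq_le e.1 (fun _ => t e.2) fun _ _ => rfl
      _ = _ := by rw [sum_const, smul_eq_mul, card_univ, Fintype.card_prod]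
  have h3 := (card_le_card hsub).trans ((card_union_le _ _).trans
    (Nat.add_le_add_left (card_union_le _ _) _))
  have h4 := Nat.mul_le_mul_left N h3
  rw [add_mul]
  linarith

/-- Almost all tuples with the absorbing pattern are absorbing. -/
theorem card_mul_card_pattern_le (q : α × Bool → ℕ) (t : α → V) :
    Fintype.card V * (univ.filter fun S => AbsorbingPattern G q t S).card ≤
      Fintype.card V * (absorbingTuples G q t).card +
        (Fintype.card (Σ j, Fin (q j)) ^ 2 + Fintype.card (Σ j, Fin (q j)) * Fintype.card α) *
          Fintype.card V ^ Fintype.card (Σ j, Fin (q j)) := by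
  convert card_mul_card_filter_le t fun S => AbsorbingPattern G q t S
  ext S
  simp [absorbingTuples]

end AbsorbingTuples

/-! ### The absorbing set -/

section Selection

/-- Greedy selection by the method of conditional expectations: a conflict-free family of `M`
elements meeting every `𝒢 t` often. -/
theorem exists_conflictFree {Ω T : Type*} [Fintype Ω] [Fintype T] [Nonempty Ω] [Nonempty T]
    (𝒢 : T → Finset Ω) (R : Ω → Ω → Prop) (hrefl : ∀ x, R x x) (hsymm : ∀ x y, R x y → R y x)
    {b r : ℝ} (hb : 0 < b)
    (hr : ∀ x, ((univ.filter fun y => R x y).card : ℝ) ≤ r * Fintype.card Ω)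
    (h𝒢 : ∀ t, b * Fintype.card Ω ≤ ((𝒢 t).card : ℝ)) (M : ℕ) (hM : M * r ≤ b / 2) :
    ∃ F : Finset Ω, F.card = M ∧ (∀ x ∈ F, ∀ y ∈ F, x ≠ y → ¬ R x y) ∧
      (∀ x ∈ F, ∃ t, x ∈ 𝒢 t) ∧
      ∑ t, (1 / 2 : ℝ) ^ (F ∩ 𝒢 t).card ≤ Fintype.card T * (1 - b / 4) ^ M := by
  have hΩ : (0 : ℝ) < Fintype.card Ω := by exact_mod_cast Fintype.card_pos
  have hr0 : 0 ≤ r := by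
    obtain ⟨x⟩ := ‹Nonempty Ω›
    by_contra hneg
    have := (Nat.cast_nonneg _).trans (hr x)
    nlinarith
  induction M with
  | zero => exact ⟨∅, by simp⟩
  | succ M ih =>
    obtain ⟨F, hcard, hconf, hmem, hsum⟩ := ih (by push_cast at hM; nlinarith)
    set Allowed : Finset Ω := univ.filter fun y => ∀ x ∈ F, ¬ R x y with hAl
    have hbad : ((univ \ Allowed).card : ℝ) ≤ b / 2 * Fintype.card Ω := by
      have hsub : univ \ Allowed ⊆ F.biUnion fun x => univ.filter fun y => R x y := by
        intro y hy
        simpa [hAl] using hy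
      calc ((univ \ Allowed).card : ℝ) ≤ ∑ x ∈ F, ((univ.filter fun y => R x y).card : ℝ) := by
            exact_mod_cast (card_le_card hsub).trans card_biUnion_le
        _ ≤ ∑ x ∈ F, r * Fintype.card Ω := sum_le_sum fun x _ => hr x
        _ = M * r * Fintype.card Ω := by rw [sum_const, hcard, nsmul_eq_mul]; ring
        _ ≤ _ := by
            refine mul_le_mul_of_nonneg_right ?_ hΩ.le
            push_cast at hM; nlinarith
    have hgood : ∀ t, b / 2 * Fintype.card Ω ≤ ((Allowed ∩ 𝒢 t).card : ℝ) := by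
      intro t
      have h1 : (𝒢 t).card ≤ (Allowed ∩ 𝒢 t).card + (univ \ Allowed).card := by
        refine (card_le_card ?_).trans (card_union_le _ _)
        intro y hy
        by_cases h : y ∈ Allowed <;> simp [h, hy]
      have h2 : ((𝒢 t).card : ℝ) ≤ (Allowed ∩ 𝒢 t).card + (univ \ Allowed).card := by
        exact_mod_cast h1
      have := h𝒢 t
      linarith
    set p : T → ℝ := fun t => (1 / 2 : ℝ) ^ (F ∩ 𝒢 t).card with hp
    have hp0 : ∀ t, 0 < p t := fun t => by positivity
    have hAne : Allowed.Nonempty := by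
      obtain ⟨t⟩ := ‹Nonempty T›
      have h1 : (0 : ℝ) < (Allowed ∩ 𝒢 t).card := lt_of_lt_of_le (by positivity) (hgood t)
      obtain ⟨y, hy⟩ := card_pos.1 (by exact_mod_cast h1)
      exact ⟨y, (mem_inter.1 hy).1⟩
    have hΦ : 0 < ∑ t, p t := sum_pos (fun t _ => hp0 t) univ_nonempty
    obtain ⟨y, hy, hyw⟩ : ∃ y ∈ Allowed, b / 2 * ∑ t, p t ≤
        ∑ t, if y ∈ 𝒢 t then p t else 0 := by
      refine exists_le_of_sum_le hAne ?_
      rw [sum_comm]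
      calc ∑ y ∈ Allowed, b / 2 * ∑ t, p t = Allowed.card * (b / 2 * ∑ t, p t) := by
            rw [sum_const, nsmul_eq_mul]
        _ ≤ Fintype.card Ω * (b / 2 * ∑ t, p t) := by
            refine mul_le_mul_of_nonneg_right ?_ (by positivity)
            exact_mod_cast card_le_univ _
        _ = ∑ t, (b / 2 * Fintype.card Ω) * p t := by rw [← mul_sum]; ring
        _ ≤ ∑ t, ((Allowed ∩ 𝒢 t).card : ℝ) * p t :=
            sum_le_sum fun t _ => mul_le_mul_of_nonneg_right (hgood t) (hp0 t).le
        _ = _ := by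
            refine sum_congr rfl fun t _ => ?_
            rw [← sum_filter, sum_const, nsmul_eq_mul, filter_mem_eq_inter]
    have hyF : y ∉ F := fun h => (mem_filter.1 hy).2 y h (hrefl y)
    refine ⟨insert y F, by rw [card_insert_of_notMem hyF, hcard], ?_, ?_, ?_⟩
    · intro x hx x' hx' hne
      rcases mem_insert.1 hx with rfl | hxF <;> rcases mem_insert.1 hx' with rfl | hxF'
      · exact absurd rfl hne
      · exact fun h => (mem_filter.1 hy).2 _ hxF' (hsymm _ _ h)
      · exact (mem_filter.1 hy).2 _ hxF
      · exact hconf _ hxF _ hxF' hne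
    · intro x hx
      rcases mem_insert.1 hx with rfl | hx
      · by_contra hcon
        push Not at hcon
        have : ∑ t, (if x ∈ 𝒢 t then p t else 0) = 0 :=
          sum_eq_zero fun t _ => if_neg (hcon t)
        rw [this] at hyw
        have : 0 < b / 2 * ∑ t, p t := by positivity
        linarith
      · exact hmem x hx
    · have hstep : ∀ t, (1 / 2 : ℝ) ^ (insert y F ∩ 𝒢 t).card =
          p t - 1 / 2 * if y ∈ 𝒢 t then p t else 0 := by
        intro t
        by_cases h : y ∈ 𝒢 t
        · rw [insert_inter_of_mem h, card_insert_of_notMem (by simp [hyF]), pow_succ, if_pos h, hp]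
          ring
        · rw [insert_inter_of_notMem h, if_neg h, hp]
          ring
      calc ∑ t, (1 / 2 : ℝ) ^ (insert y F ∩ 𝒢 t).card =
            ∑ t, p t - 1 / 2 * ∑ t, if y ∈ 𝒢 t then p t else 0 := by
            rw [sum_congr rfl fun t _ => hstep t, sum_sub_distrib, mul_sum]
        _ ≤ (1 - b / 4) * ∑ t, p t := by linarith
        _ ≤ (1 - b / 4) * (Fintype.card T * (1 - b / 4) ^ M) := by
            refine mul_le_mul_of_nonneg_left hsum ?_
            obtain ⟨t⟩ := ‹Nonempty T›
            have h1 : ((𝒢 t).card : ℝ) ≤ Fintype.card Ω := by exact_mod_cast card_le_univ _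
            have := h𝒢 t
            nlinarith
        _ = _ := by rw [pow_succ]; ring

theorem exists_lt_of_exp_bound (h : ℕ) {b e : ℝ} (hb : 0 < b) (he : 0 < e) (hb1 : b ≤ 1) :
    ∃ N₀ : ℕ, ∀ N : ℕ, N₀ ≤ N → ∀ M L : ℕ, e * N - 1 ≤ M →
      (1 / 2 : ℝ) ^ L ≤ N ^ h * (1 - b / 4) ^ M → b * e / 8 * N < L := by
  have hlo := (isLittleO_pow_exp_pos_mul_atTop h (b := b * e / 8) (by positivity)).def
    (c := Real.exp (-1) / 2) (by positivity)
  obtain ⟨x₀, hx₀⟩ := Filter.eventually_atTop.1 hlo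
  refine ⟨⌈x₀⌉₊, fun N hN M L hM hle => ?_⟩
  have h1 := hx₀ N ((Nat.le_ceil _).trans (by exact_mod_cast hN))
  rw [Real.norm_of_nonneg (by positivity), Real.norm_of_nonneg (by positivity)] at h1
  by_contra! hL
  have h2 : Real.exp (-L) ≤ (1 / 2 : ℝ) ^ L := by
    rw [← mul_neg_one, Real.exp_nat_mul]
    gcongr
    have := Real.exp_one_gt_d9
    rw [Real.exp_neg, ← one_div]
    gcongr
    linarith
  have h3 : (1 - b / 4) ^ M ≤ Real.exp (M * (-(b / 4))) := by
    rw [Real.exp_nat_mul]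
    refine pow_le_pow_left₀ (by linarith) ?_ _
    have := Real.add_one_le_exp (-(b / 4))
    linarith
  have h4 : Real.exp (M * (-(b / 4))) ≤ Real.exp (1 - b * e / 4 * N) := by
    refine Real.exp_le_exp.2 ?_
    nlinarith
  have h5 : Real.exp (-(b * e / 8 * N)) ≤ Real.exp (-L) := Real.exp_le_exp.2 (by linarith)
  have h6 : Real.exp (-(b * e / 8 * N)) ≤ N ^ h * Real.exp (1 - b * e / 4 * N) :=
    h5.trans (h2.trans (hle.trans (mul_le_mul_of_nonneg_left (h3.trans h4) (by positivity))))
  have h7 : (N : ℝ) ^ h * Real.exp (1 - b * e / 4 * N) ≤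
      Real.exp (-1) / 2 * Real.exp (b * e / 8 * N) * Real.exp (1 - b * e / 4 * N) :=
    mul_le_mul_of_nonneg_right h1 (Real.exp_pos _).le
  have h8 : Real.exp (-1) / 2 * Real.exp (b * e / 8 * N) * Real.exp (1 - b * e / 4 * N) =
      Real.exp (-(b * e / 8 * N)) / 2 := by
    rw [div_mul_eq_mul_div, div_mul_eq_mul_div, ← Real.exp_add, ← Real.exp_add]
    ring_nf
  have := Real.exp_pos (-(b * e / 8 * N))
  linarith

end Selection

section Absorb

variable {E : Type*} [Fintype E] [Fintype α] [Fintype V] {H : SimpleGraph α} {G : SimpleGraph V}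

theorem tileable_biUnion_union (𝒢 : (α → V) → Finset (E → V))
    (h𝒢 : ∀ t, Function.Injective t → ∀ S ∈ 𝒢 t, Tileable H G (univ.image S ∪ univ.image t))
    (b : ℕ) : ∀ (F : Finset (E → V)) (W : Finset V), (∀ S ∈ F, Tileable H G (univ.image S)) →
      (∀ S ∈ F, ∀ S' ∈ F, S ≠ S' → Disjoint (univ.image S) (univ.image S')) →
      (∀ S ∈ F, Disjoint (univ.image S) W) →
      (∀ t, Function.Injective t → b ≤ (F ∩ 𝒢 t).card) →
      W.card = Fintype.card α * b →
      Tileable H G (F.biUnion (fun S => univ.image S) ∪ W) := by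
  induction b with
  | zero =>
    intro F W hF hd hW hb hc
    rw [mul_zero, card_eq_zero] at hc
    subst hc
    rw [union_empty]
    clear hW hb
    induction F using Finset.induction_on with
    | empty => simpa using tileable_empty
    | insert S F hS ih =>
      rw [biUnion_insert]
      refine (hF S (mem_insert_self _ _)).union
        (ih (fun S' h => hF S' (mem_insert_of_mem h)) fun S' h S'' h' =>
          hd S' (mem_insert_of_mem h) S'' (mem_insert_of_mem h')) ?_
      rw [disjoint_biUnion_right]
      exact fun S' h => hd S (mem_insert_self _ _) S' (mem_insert_of_mem h)
        fun heq => hS (heq ▸ h)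
  | succ b ih =>
    intro F W hF hd hW hb hc
    obtain ⟨W₀, hW₀, hc₀⟩ := exists_subset_card_eq (s := W) (n := Fintype.card α)
      (by rw [hc, mul_add]; omega)
    have e : α ≃ W₀ := Fintype.equivOfCardEq (by rw [Fintype.card_coe, hc₀])
    set t : α → V := fun a => e a with ht
    have htinj : Function.Injective t := Subtype.val_injective.comp e.injective
    have htW : univ.image t = W₀ := by
      ext x
      simp only [mem_image, mem_univ, true_and]
      constructor
      · rintro ⟨a, rfl⟩; exact (e a).2
      · exact fun hx => ⟨e.symm ⟨x, hx⟩, by simp [ht]⟩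
    obtain ⟨S, hS⟩ := card_pos.1 (lt_of_lt_of_le (Nat.succ_pos b) (hb t htinj))
    obtain ⟨hSF, hSt⟩ := mem_inter.1 hS
    have h1 := h𝒢 t htinj S hSt
    rw [htW] at h1
    have h2 := ih (F.erase S) (W \ W₀) (fun S' h => hF S' (mem_of_mem_erase h))
      (fun S' h S'' h' => hd S' (mem_of_mem_erase h) S'' (mem_of_mem_erase h'))
      (fun S' h => (hW S' (mem_of_mem_erase h)).mono_right sdiff_subset)
      (fun t' ht' => by
        have h3 := hb t' ht'
        rw [erase_inter]
        have := pred_card_le_card_erase (s := F ∩ 𝒢 t') (a := S)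
        omega)
      (by rw [card_sdiff_of_subset hW₀, hc, hc₀, mul_add]; omega)
    have h3 := h1.union h2 (by
      rw [disjoint_union_left, disjoint_union_right, disjoint_union_right, disjoint_biUnion_right,
        disjoint_biUnion_right]
      refine ⟨⟨fun S' h => ?_, (hW S hSF).mono_right sdiff_subset⟩, fun S' h => ?_,
        disjoint_sdiff⟩
      · exact hd S hSF S' (mem_of_mem_erase h) (ne_of_mem_erase h).symm
      · exact ((hW S' (mem_of_mem_erase h)).mono_right hW₀).symm)
    convert h3 using 1
    conv_lhs => rw [← insert_erase hSF, biUnion_insert, ← union_sdiff_of_subset hW₀]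
    ac_rfl

theorem card_conflict_le (x : E → V) :
    Fintype.card V * (univ.filter fun y : E → V =>
      ¬ Disjoint (univ.image x) (univ.image y)).card ≤
      Fintype.card E ^ 2 * Fintype.card V ^ Fintype.card E := by
  have hsub : (univ.filter fun y : E → V => ¬ Disjoint (univ.image x) (univ.image y)) ⊆
      (univ : Finset (E × E)).biUnion fun e => univ.filter fun y => y e.1 = x e.2 := by
    intro y hy
    simp only [mem_filter, mem_univ, true_and, not_disjoint_iff, mem_image, mem_biUnion,
      Prod.exists] at hy ⊢
    obtain ⟨_, ⟨e, rfl⟩, e', h⟩ := hy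
    exact ⟨e', e, h⟩
  calc _ ≤ Fintype.card V * ∑ e : E × E, (univ.filter fun y : E → V => y e.1 = x e.2).card :=
        Nat.mul_le_mul_left _ ((card_le_card hsub).trans card_biUnion_le)
    _ = ∑ e : E × E, Fintype.card V * (univ.filter fun y : E → V => y e.1 = x e.2).card :=
        mul_sum _ _ _
    _ ≤ ∑ e : E × E, Fintype.card V ^ Fintype.card E :=
        sum_le_sum fun e _ => card_mul_card_filter_eq_le e.1 (fun _ => x e.2) fun _ _ => rfl
    _ = _ := by rw [sum_const, smul_eq_mul, card_univ, Fintype.card_prod, sq]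

/-- Abundance of absorbing tuples yields an absorbing set. -/
theorem exists_absorbing_of_abundant {α E : Type*} [Fintype α] [Nonempty α] [Fintype E]
    [Nonempty E] {b : ℝ} (hb0 : 0 < b) (hb1 : b ≤ 1) {η : ℝ} (hη : 0 < η) :
    ∃ ω : ℝ, 0 < ω ∧ ∃ N₀ : ℕ, ∀ (V : Type) [Fintype V] (H : SimpleGraph α) (G : SimpleGraph V)
      (𝒢 : (α → V) → Finset (E → V)), N₀ ≤ Fintype.card V →
      (∀ t, b * (Fintype.card V : ℝ) ^ Fintype.card E ≤ ((𝒢 t).card : ℝ)) →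
      (∀ t, ∀ S ∈ 𝒢 t, Tileable H G (univ.image S)) →
      (∀ t, Function.Injective t → ∀ S ∈ 𝒢 t, Tileable H G (univ.image S ∪ univ.image t)) →
      ∃ A : Finset V, Tileable H G A ∧ (A.card : ℝ) ≤ η * Fintype.card V ∧
        ∀ W : Finset V, Disjoint A W → (W.card : ℝ) ≤ ω * Fintype.card V →
          Fintype.card α ∣ W.card → Tileable H G (A ∪ W) := by
  set k := Fintype.card E with hk
  set h := Fintype.card α with hh
  have hkpos : 0 < k := Fintype.card_pos
  have hk1 : (1 : ℝ) ≤ k := by exact_mod_cast hkpos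
  set e := min η (b / 2) / k ^ 2 with he
  have he0 : 0 < e := by positivity
  obtain ⟨N₁, hN₁⟩ := exists_lt_of_exp_bound h hb0 he0 hb1
  refine ⟨b * e / 8, by positivity, max (max N₁ 1) h, ?_⟩
  intro V _ H G 𝒢 hN h𝒢 h𝒢tile h𝒢abs
  set N := Fintype.card V with hNdef
  simp only [max_le_iff] at hN
  obtain ⟨⟨hN1, hN0⟩, hNh⟩ := hN
  have hNpos : (0 : ℝ) < N := by exact_mod_cast hN0
  have hVne : Nonempty V := Fintype.card_pos_iff.1 hN0
  have hcardΩ : (Fintype.card (E → V) : ℝ) = (N : ℝ) ^ k := by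
    rw [hk, hNdef]; simp only [Fintype.card_fun]; push_cast; rfl
  set M := ⌊e * N⌋₊ with hM
  have hMle : (M : ℝ) ≤ e * N := Nat.floor_le (by positivity)
  have hk2 : (0 : ℝ) < k ^ 2 := by positivity
  have hek : e * k ^ 2 = min η (b / 2) := by rw [he]; field_simp
  have hT : Nonempty {t : α → V // Function.Injective t} := by
    obtain ⟨f⟩ := Function.Embedding.nonempty_of_card_le (α := α) (β := V) hNh
    exact ⟨⟨f, f.injective⟩⟩
  obtain ⟨F, hFc, hconf, hmem, hsum⟩ := exists_conflictFree
    (T := {t : α → V // Function.Injective t}) (fun t => 𝒢 t)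
    (fun x y => ¬ Disjoint (univ.image x) (univ.image y))
    (fun x => by simp [univ_nonempty.ne_empty]) (fun x y hxy => fun h' => hxy h'.symm)
    (r := k ^ 2 / N) hb0 (fun x => by
      rw [hcardΩ]
      have h1 : (N : ℝ) * (univ.filter fun y : E → V =>
          ¬ Disjoint (univ.image x) (univ.image y)).card ≤ k ^ 2 * N ^ k := by
        exact_mod_cast card_conflict_le x
      rw [div_mul_eq_mul_div, le_div_iff₀ hNpos, mul_comm]
      refine le_trans (le_of_eq ?_) h1
      congr!) (fun t => hcardΩ ▸ h𝒢 t) M (by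
      rw [← mul_div_assoc, div_le_iff₀ hNpos]
      calc (M : ℝ) * k ^ 2 ≤ e * N * k ^ 2 := by gcongr
        _ = min η (b / 2) * N := by rw [← hek]; ring
        _ ≤ _ := by gcongr; exact min_le_right _ _)
  have hmany : ∀ t : α → V, Function.Injective t →
      b * e / 8 * N < ((F ∩ 𝒢 t).card : ℝ) := by
    intro t ht
    refine hN₁ N hN1 M _ (by have := Nat.lt_floor_add_one (e * N); linarith) ?_
    refine le_trans ?_ (hsum.trans ?_)
    · refine (single_le_sum (f := fun t : {t : α → V // Function.Injective t} =>
        (1 / 2 : ℝ) ^ (F ∩ 𝒢 t).card) (fun _ _ => by positivity)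
        (mem_univ (⟨t, ht⟩ : {t : α → V // Function.Injective t}))).trans (le_of_eq ?_)
      refine sum_congr rfl fun _ _ => ?_
      congr!
    · refine mul_le_mul_of_nonneg_right ?_ (pow_nonneg (by linarith) _)
      have h1 := Fintype.card_subtype_le fun t : α → V => Function.Injective t
      have h2 : Fintype.card (α → V) = N ^ h := by rw [hh, hNdef]; simp
      rw [h2] at h1
      have h3 : (Fintype.card {t : α → V // Function.Injective t} : ℝ) ≤ (N : ℝ) ^ h := by
        exact_mod_cast h1
      convert h3
  have hFtile : ∀ S ∈ F, Tileable H G (univ.image S) := fun S hS => by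
    obtain ⟨t, ht⟩ := hmem S hS
    exact h𝒢tile t S ht
  have hFdis : ∀ S ∈ F, ∀ S' ∈ F, S ≠ S' → Disjoint (univ.image S) (univ.image S') :=
    fun S hS S' hS' hne => by simpa using hconf S hS S' hS' hne
  have habs : ∀ W : Finset V, Disjoint (F.biUnion fun S => univ.image S) W →
      (W.card : ℝ) ≤ b * e / 8 * N → Fintype.card α ∣ W.card →
      Tileable H G ((F.biUnion fun S => univ.image S) ∪ W) := by
    rintro W hdis hW ⟨m, hm⟩
    refine tileable_biUnion_union 𝒢
      h𝒢abs m F W hFtile hFdis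
      (fun S hS => hdis.mono_left (subset_biUnion_of_mem (fun S => univ.image S) hS)) ?_ hm
    intro t ht
    have h1 := hmany t ht
    have h2 : m ≤ W.card := by rw [hm]; exact Nat.le_mul_of_pos_left _ Fintype.card_pos
    have h3 : (m : ℝ) ≤ W.card := by exact_mod_cast h2
    exact_mod_cast (h3.trans hW).trans h1.le
  refine ⟨F.biUnion fun S => univ.image S, ?_, ?_, habs⟩
  · have := habs ∅ (disjoint_empty_right _) (by rw [card_empty, Nat.cast_zero]; positivity)
      (by simp)
    simpa using this
  · have h1 : (F.biUnion fun S => univ.image S).card ≤ M * k := by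
      rw [← hFc]
      exact card_biUnion_le_card_mul _ _ _ fun S _ => card_image_le
    have h2 : ((F.biUnion fun S => univ.image S).card : ℝ) ≤ M * k := by exact_mod_cast h1
    calc _ ≤ (M : ℝ) * k := h2
      _ ≤ e * N * k ^ 2 := by
          have : (k : ℝ) ≤ k ^ 2 := by nlinarith
          gcongr
      _ = min η (b / 2) * N := by rw [← hek]; ring
      _ ≤ η * N := by gcongr; exact min_le_left _ _

/-- The absorbing lemma: a small tileable set absorbing every small set of the right size. -/
theorem exists_absorbing {α : Type*} [Fintype α] [Nonempty α] {H : SimpleGraph α}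
    (hbip : IsBip H) (hhcf : HcfOne H) {c : ℝ} (hc : 0 < c) {η : ℝ} (hη : 0 < η) :
    ∃ ω : ℝ, 0 < ω ∧ ∃ N₀ : ℕ, ∀ (V : Type) [Fintype V] (G : SimpleGraph V),
      N₀ ≤ Fintype.card V → (∀ v, c * Fintype.card V ≤ G.degree v) →
      ∃ A : Finset V, Tileable H G A ∧ (A.card : ℝ) ≤ η * Fintype.card V ∧
        ∀ W : Finset V, Disjoint A W → (W.card : ℝ) ≤ ω * Fintype.card V →
          Fintype.card α ∣ W.card → Tileable H G (A ∪ W) := by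
  obtain ⟨q, hq, ⟨j₀, hj₀⟩, hq'⟩ := exists_realizable_add_one hbip hhcf
  have hEne : Nonempty (Σ j, Fin (q j)) := ⟨⟨j₀, ⟨0, Nat.pos_of_ne_zero hj₀⟩⟩⟩
  set k := Fintype.card (Σ j, Fin (q j)) with hk
  set h := Fintype.card α with hh
  set K := ∑ i, (q (i, false) * q (i, true) + q (i, true)) with hK
  set c' := min c 1 with hc'
  have hc'0 : 0 < c' := lt_min hc one_pos
  set b := c' ^ K / 2 with hb
  have hb0 : 0 < b := by positivity
  have hb1 : b ≤ 1 := by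
    have : c' ^ K ≤ 1 := pow_le_one₀ hc'0.le (min_le_right _ _)
    linarith
  obtain ⟨ω, hω, N₁, hN₁⟩ := exists_absorbing_of_abundant (α := α) (E := Σ j, Fin (q j))
    hb0 hb1 hη
  refine ⟨ω, hω, max N₁ (max 1 ⌈(k ^ 2 + k * h) / b⌉₊), ?_⟩
  intro V _ G hN hdeg
  simp only [max_le_iff] at hN
  obtain ⟨hN1, hN0, hNb⟩ := hN
  refine hN₁ V H G (absorbingTuples G q) hN1 ?_
    (fun t S hS => tileable_of_mem_absorbingTuples hS hq)
    (fun t ht S hS => tileable_union_of_mem_absorbingTuples ht hS hq')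
  intro t
  set N := Fintype.card V with hNdef
  have hNpos : (0 : ℝ) < N := by exact_mod_cast hN0
  have hNb' : (k ^ 2 + k * h : ℝ) ≤ b * N := by
    have := Nat.ceil_le.1 hNb
    rw [div_le_iff₀ hb0] at this
    linarith
  have h1 := le_card_pattern q t hc'0.le fun v =>
    (mul_le_mul_of_nonneg_right (min_le_left c 1) hNpos.le).trans (hdeg v)
  have h2 : (N : ℝ) * (univ.filter fun S => AbsorbingPattern G q t S).card ≤
      N * (absorbingTuples G q t).card + (k ^ 2 + k * h) * N ^ k := by
    exact_mod_cast card_mul_card_pattern_le (G := G) q t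
  have h3 : c' ^ K = 2 * b := by rw [hb]; ring
  rw [← hK, h3] at h1
  have h4 : (N : ℝ) * (2 * b * N ^ k) ≤ N * (absorbingTuples G q t).card + b * N * N ^ k :=
    (mul_le_mul_of_nonneg_left h1 hNpos.le).trans
      (h2.trans (by gcongr))
  have h5 : (N : ℝ) * (b * N ^ k) ≤ N * (absorbingTuples G q t).card := by linarith
  exact le_of_mul_le_mul_left h5 hNpos

end Absorb

/-! ### Fractional tilings of weighted reduced graphs -/

section Fractional

open MeasureTheory in
theorem integral_Ioc_ite_le {x T : ℝ} (hx : 0 ≤ x) (hT : x ≤ T) :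
    ∫ t in Set.Ioc 0 T, (if t ≤ x then (1 : ℝ) else 0) = x := by
  have h1 : (fun t : ℝ => if t ≤ x then (1 : ℝ) else 0) = (Set.Iic x).indicator fun _ => 1 := by
    ext t; simp [Set.indicator]
  rw [h1, setIntegral_indicator measurableSet_Iic, setIntegral_const]
  have : Set.Ioc 0 T ∩ Set.Iic x = Set.Ioc 0 x := by
    ext t
    simp only [Set.mem_inter_iff, Set.mem_Ioc, Set.mem_Iic]
    constructor
    · rintro ⟨⟨h1, -⟩, h2⟩; exact ⟨h1, h2⟩
    · rintro ⟨h1, h2⟩; exact ⟨⟨h1, h2.trans hT⟩, h2⟩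
  simp [this, measureReal_def, hx]

open MeasureTheory in
theorem integrableOn_Ioc_ite_le (x T : ℝ) :
    IntegrableOn (fun t => if t ≤ x then (1 : ℝ) else 0) (Set.Ioc 0 T) := by
  have h1 : (fun t : ℝ => if t ≤ x then (1 : ℝ) else 0) = (Set.Iic x).indicator fun _ => 1 := by
    ext t; simp [Set.indicator]
  rw [h1]
  exact (integrableOn_const (by simp)).indicator measurableSet_Iic

/-- Comparing weighted sums through their superlevel sets. -/
theorem sum_mul_le_of_superlevel {ι : Type*} [Fintype ι] {s r f g : ι → ℝ}
    (hf : ∀ x, 0 ≤ f x) (hg : ∀ x, 0 ≤ g x)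
    (h : ∀ t, 0 < t → ∑ x, (if t ≤ f x then s x else 0) ≤ ∑ x, if t ≤ g x then r x else 0) :
    ∑ x, s x * f x ≤ ∑ x, r x * g x := by
  set T := ∑ x, (f x + g x) with hT
  have hle : ∀ x, f x + g x ≤ T := fun x =>
    single_le_sum (f := fun x => f x + g x) (fun y _ => add_nonneg (hf y) (hg y)) (mem_univ x)
  have key : ∀ (s f : ι → ℝ), (∀ x, 0 ≤ f x) → (∀ x, f x ≤ T) →
      ∑ x, s x * f x = ∫ t in Set.Ioc 0 T, ∑ x, if t ≤ f x then s x else 0 := by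
    intro s f hf hfT
    have h1 : ∀ t x, (if t ≤ f x then s x else 0) = s x * if t ≤ f x then (1 : ℝ) else 0 := by
      intro t x; split_ifs <;> simp
    simp_rw [h1]
    rw [MeasureTheory.integral_finsetSum _ fun x _ =>
      (integrableOn_Ioc_ite_le (f x) T).const_mul (s x)]
    refine sum_congr rfl fun x _ => ?_
    rw [MeasureTheory.integral_const_mul, integral_Ioc_ite_le (hf x) (hfT x)]
  have h_int : ∀ (s f : ι → ℝ), MeasureTheory.IntegrableOn
      (fun t => ∑ x, if t ≤ f x then s x else 0) (Set.Ioc 0 T) := by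
    intro s f
    refine MeasureTheory.integrable_finsetSum _ fun x _ => ?_
    have h1 : (fun t => if t ≤ f x then s x else 0) =
        fun t => s x * if t ≤ f x then (1 : ℝ) else 0 := by
      ext t; split_ifs <;> simp
    rw [h1]
    exact (integrableOn_Ioc_ite_le (f x) T).const_mul (s x)
  rw [key s f hf fun x => by have := hle x; have := hg x; linarith,
    key r g hg fun x => by have := hle x; have := hf x; linarith]
  exact MeasureTheory.setIntegral_mono_on (h_int _ _) (h_int _ _) measurableSet_Ioc
    fun t ht => h t ht.1

/-- Farkas alternative for fractional tilings. -/
theorem exists_weights_or_potential {ι : Type*} [Fintype ι] (s : ι → ℝ) (hs : ∀ x, 0 ≤ s x)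
    (R : ι → ι → Prop) {u w : ℝ} (huw : 0 < u + w) :
    (∃ l : ι → ι → ℝ, (∀ x y, 0 ≤ l x y) ∧ (∀ x y, l x y ≠ 0 → R x y) ∧
      ∀ z, ∑ y, (u * l z y + w * l y z) = s z) ∨
    ∃ g : ι → ℝ, (∀ x y, R x y → 0 < u * g x + w * g y) ∧ ∑ x, s x * g x < 0 := by
  set I := {p : ι × ι // R p.1 p.2}
  let L : (I → ℝ) →ₗ[ℝ] (ι → ℝ) :=
    { toFun := fun l z => ∑ p : I, l p * (u * (if z = p.1.1 then (1 : ℝ) else 0) +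
        w * (if z = p.1.2 then (1 : ℝ) else 0))
      map_add' := fun l l' => by
        ext z; simp only [Pi.add_apply, add_mul, sum_add_distrib]
      map_smul' := fun c l => by
        ext z; simp only [Pi.smul_apply, smul_eq_mul, mul_sum, RingHom.id_apply, mul_assoc] }
  have hL : ∀ l z, L l z = ∑ p : I, l p * (u * (if z = p.1.1 then (1 : ℝ) else 0) +
        w * (if z = p.1.2 then (1 : ℝ) else 0)) := fun _ _ => rfl
  rcases (sum_nonneg fun x (_ : x ∈ univ) => hs x).eq_or_lt with hS | hS
  · left
    refine ⟨0, by simp, by simp, fun z => ?_⟩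
    have := (sum_eq_zero_iff_of_nonneg fun x _ => hs x).1 hS.symm z (mem_univ z)
    simp [this]
  set S := ∑ x, s x with hSdef
  by_cases hmem : (fun z => (u + w) / S * s z) ∈ L '' stdSimplex ℝ I
  · left
    obtain ⟨l, ⟨hl0, -⟩, hl⟩ := hmem
    refine ⟨fun x y => if h : R x y then S / (u + w) * l ⟨(x, y), h⟩ else 0, ?_, ?_, ?_⟩
    · intro x y
      dsimp only
      split_ifs
      · exact mul_nonneg (by positivity) (hl0 _)
      · exact le_rfl
    · intro x y h
      by_contra hR
      simp [hR] at h
    · intro z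
      have h1 := congrFun hl z
      simp only [hL] at h1
      set m : ι → ι → ℝ := fun x y => if h : R x y then l ⟨(x, y), h⟩ else 0 with hm
      have hlm : ∀ x y, (if h : R x y then S / (u + w) * l ⟨(x, y), h⟩ else 0) =
          S / (u + w) * m x y := by
        intro x y; simp only [hm]; split_ifs <;> simp
      simp_rw [hlm]
      have h2 : ∑ p : I, l p * (u * (if z = p.1.1 then (1 : ℝ) else 0) + w * (if z = p.1.2 then (1 : ℝ) else 0)) =
          ∑ x, ∑ y, m x y * (u * (if z = x then (1 : ℝ) else 0) + w * (if z = y then (1 : ℝ) else 0)) := by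
        rw [← Fintype.sum_prod_type']
        rw [← sum_filter_of_ne (p := fun p : ι × ι => R p.1 p.2), sum_subtype (p := fun p : ι × ι =>
          R p.1 p.2) _ (by simp)]
        · refine sum_congr rfl fun p _ => ?_
          simp only [hm, p.2, dif_pos]
          rfl
        · intro p _ hp
          by_contra hR
          simp [hm, hR] at hp
      rw [h2] at h1
      have h3 : ∑ x, ∑ y, m x y * (u * (if z = x then (1 : ℝ) else 0) + w * (if z = y then (1 : ℝ) else 0)) =
          ∑ y, (u * m z y + w * m y z) := by
        simp only [mul_add, sum_add_distrib, mul_ite, mul_one, mul_zero]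
        congr 1
        · rw [sum_comm]
          simp [mul_comm]
        · simp [mul_comm]
      rw [h3] at h1
      have h4 : ∑ y, (u * (S / (u + w) * m z y) + w * (S / (u + w) * m y z)) =
          S / (u + w) * ∑ y, (u * m z y + w * m y z) := by
        rw [mul_sum]; exact sum_congr rfl fun y _ => by ring
      rw [h4, h1]
      field_simp
  · right
    have hcl : IsClosed (L '' stdSimplex ℝ I) :=
      ((isCompact_stdSimplex ℝ I).image L.continuous_of_finiteDimensional).isClosed
    have hcv : Convex ℝ (L '' stdSimplex ℝ I) := (convex_stdSimplex ℝ I).linear_image L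
    obtain ⟨f, c, hf1, hf2⟩ := geometric_hahn_banach_point_closed hcv hcl hmem
    have hfsum : ∀ v : ι → ℝ, f v = ∑ z, v z * f (Pi.single z 1) := by
      intro v
      conv_lhs => rw [pi_eq_sum_univ' v]
      simp only [map_sum, map_smul, smul_eq_mul]
    refine ⟨fun z => f (Pi.single z 1) - c / (u + w), ?_, ?_⟩
    · intro x y hxy
      have h1 := hf2 (L (Pi.single ⟨(x, y), hxy⟩ 1))
        ⟨_, single_mem_stdSimplex ℝ _, rfl⟩
      have h2 : L (Pi.single ⟨(x, y), hxy⟩ 1) = u • Pi.single x (1 : ℝ) + w • Pi.single y (1 : ℝ) := by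
        ext z
        rw [hL, sum_eq_single ⟨(x, y), hxy⟩]
        · simp [Pi.single_apply]
        · intro p _ hp; simp [hp]
        · simp
      rw [h2, map_add, map_smul, map_smul, smul_eq_mul, smul_eq_mul] at h1
      have h3 : (u + w) * (c / (u + w)) = c := by field_simp
      nlinarith
    · rw [hfsum] at hf1
      have h1 : ∑ x, s x * (f (Pi.single x 1) - c / (u + w)) =
          S / (u + w) * (∑ z, (u + w) / S * s z * f (Pi.single z 1) - c) := by
        simp only [mul_sub, sum_sub_distrib, ← sum_mul, mul_sum]
        congr 1
        · refine sum_congr rfl fun x _ => ?_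
          field_simp
        · rw [← hSdef]; ring
      rw [h1]
      exact mul_neg_of_pos_of_neg (by positivity) (by linarith)

/-- Either there is a perfect fractional tiling, or two large sets on opposite sides span no
edge. -/
theorem exists_fractional_tiling {ι : Type*} [Fintype ι] (side : ι → Bool) (s : ι → ℝ)
    (hs : ∀ x, 0 ≤ s x) (R : ι → ι → Prop) (hR : ∀ x y, R x y → R y x)
    {u w : ℝ} (hu : 0 < u) (hw : 0 < w) :
    (∃ l : ι → ι → ℝ, (∀ x y, 0 ≤ l x y) ∧ (∀ x y, l x y ≠ 0 → R x y) ∧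
      ∀ z, ∑ y, (u * l z y + w * l y z) = s z) ∨
    ∃ (b : Bool) (A B : Finset ι), (∀ x ∈ A, side x = b) ∧ (∀ x ∈ B, side x = !b) ∧
      (∀ x ∈ A, ∀ y ∈ B, ¬ R x y) ∧
      w * (∑ x with side x = !b, s x - ∑ x ∈ B, s x) < u * ∑ x ∈ A, s x := by
  rcases exists_weights_or_potential s hs R (add_pos hu hw) with h | ⟨g, hg, hneg⟩
  · exact Or.inl h
  right
  by_contra! hcon
  have key : ∀ b : Bool, ∑ x, (if side x = b then u * s x else 0) * max (-g x) 0 ≤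
      ∑ x, (if side x = !b then w * s x else 0) * (u / w * max (g x) 0) := by
    intro b
    refine sum_mul_le_of_superlevel (fun x => le_max_right _ _)
      (fun x => mul_nonneg (by positivity) (le_max_right _ _)) fun t ht => ?_
    have h1 := hcon b (univ.filter fun x => side x = b ∧ g x ≤ -t)
      (univ.filter fun x => side x = !b ∧ g x < w / u * t) (by simp +contextual)
      (by simp +contextual) (by
        intro x hx y hy hxy
        simp only [mem_filter, mem_univ, true_and] at hx hy
        have h1 := hg y x (hR _ _ hxy)
        have h2 : u * g y < w * t := by
          calc u * g y < u * (w / u * t) := mul_lt_mul_of_pos_left hy.2 hu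
            _ = w * t := by field_simp
        nlinarith [hx.2])
    have h2 : ∑ x, (if t ≤ max (-g x) 0 then if side x = b then u * s x else 0 else 0) =
        u * ∑ x with side x = b ∧ g x ≤ -t, s x := by
      rw [mul_sum, sum_filter]
      refine sum_congr rfl fun x _ => ?_
      have : t ≤ max (-g x) 0 ↔ g x ≤ -t := by
        rw [le_max_iff]
        constructor
        · rintro (h | h) <;> linarith
        · intro h; left; linarith
      simp only [this]
      by_cases h1 : side x = b <;> by_cases h2 : g x ≤ -t <;> simp [h1, h2]
    have h3 : ∑ x, (if t ≤ u / w * max (g x) 0 then if side x = !b then w * s x else 0 else 0) =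
        w * (∑ x with side x = !b, s x - ∑ x with side x = !b ∧ g x < w / u * t, s x) := by
      rw [sum_filter, sum_filter, ← sum_sub_distrib, mul_sum]
      refine sum_congr rfl fun x _ => ?_
      have : t ≤ u / w * max (g x) 0 ↔ ¬ g x < w / u * t := by
        rw [not_lt, div_mul_eq_mul_div, le_div_iff₀ hw, div_mul_eq_mul_div, div_le_iff₀ hu]
        constructor
        · intro h
          rcases le_max_iff.1 (le_refl (max (g x) 0)) with h' | h'
          · nlinarith
          · have : 0 < t * w := by positivity
            have : 0 < u * max (g x) 0 := by linarith
            nlinarith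
        · intro h
          have := mul_le_mul_of_nonneg_left (le_max_left (g x) 0) hu.le
          linarith
      simp only [this]
      by_cases h1 : side x = !b <;> by_cases h2 : g x < w / u * t <;> simp [h1, h2]
    rw [h2, h3]
    exact h1
  have h1 := key true
  have h2 := key false
  have h3 : ∑ x, (if side x = true then u * s x else 0) * max (-g x) 0 +
      ∑ x, (if side x = false then u * s x else 0) * max (-g x) 0 =
      u * ∑ x, s x * max (-g x) 0 := by
    rw [← sum_add_distrib, mul_sum]
    refine sum_congr rfl fun x _ => ?_
    cases side x <;> simp [mul_assoc]
  have h4 : ∑ x, (if side x = !true then w * s x else 0) * (u / w * max (g x) 0) +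
      ∑ x, (if side x = !false then w * s x else 0) * (u / w * max (g x) 0) =
      u * ∑ x, s x * max (g x) 0 := by
    rw [← sum_add_distrib, mul_sum]
    refine sum_congr rfl fun x _ => ?_
    cases side x <;> simp <;> field_simp
  have h5 : ∑ x, s x * g x = ∑ x, s x * max (g x) 0 - ∑ x, s x * max (-g x) 0 := by
    rw [← sum_sub_distrib]
    refine sum_congr rfl fun x _ => ?_
    rw [← mul_sub, max_zero_sub_max_neg_zero_eq_self]
  nlinarith

end Fractional

/-! ### Embedding copies into dense pairs -/

section Embedding

variable [Fintype α] {H : SimpleGraph α}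

/-- A dense pair of linear-sized sets contains a copy of `H` respecting a given colouring. -/
theorem exists_copy_of_dense {c₀ : α → Bool} (hc₀ : Proper2Coloring H c₀) {d μ : ℝ}
    (hd : 0 < d) (hμ : 0 < μ) :
    ∃ N₀ : ℕ, ∀ (V : Type) [Fintype V] (G : SimpleGraph V) (P Q : Finset V),
      N₀ ≤ Fintype.card V →
      μ * Fintype.card V ≤ P.card → μ * Fintype.card V ≤ Q.card →
      d * (P.card * Q.card) ≤ eAB G P Q →
      ∃ f : α → V, IsCopy H G f ∧ ∀ a, f a ∈ if c₀ a = false then P else Q := by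
  set m := Fintype.card {a // c₀ a = false} * Fintype.card {a // ¬ c₀ a = false} with hm
  set h := Fintype.card α with hh
  have hcard : Fintype.card {a // c₀ a = false} + Fintype.card {a // ¬ c₀ a = false} = h := by
    rw [hh, ← Fintype.card_sum]
    exact Fintype.card_congr (Equiv.sumCompl _)
  refine ⟨⌊h ^ 2 / (d ^ m * μ ^ h)⌋₊ + 1, fun V _ G P Q hN hP hQ he => ?_⟩
  set N := Fintype.card V with hNdef
  have hN' : (h ^ 2 : ℝ) < d ^ m * μ ^ h * N := by
    have := Nat.lt_of_floor_lt (Nat.lt_of_succ_le hN)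
    rw [div_lt_iff₀ (by positivity)] at this
    linarith
  have hNpos : (0 : ℝ) < N := by
    have : 0 < N := lt_of_lt_of_le (Nat.succ_pos _) hN
    exact_mod_cast this
  obtain ⟨Pat, hPat⟩ : ∃ Pat : (α → V) → Prop, Pat = fun S =>
      (∀ a, S a ∈ if c₀ a = false then P else Q) ∧
        ∀ a b, c₀ a = false → ¬ c₀ b = false → G.Adj (S a) (S b) := ⟨_, rfl⟩
  have h1 : (completePairs G P Q {a // c₀ a = false} {a // ¬ c₀ a = false}).card ≤
      (univ.filter fun S => Pat S).card := by
    refine card_le_card_of_injOn (fun f a => if h : c₀ a = false then f.1 ⟨a, h⟩ else f.2 ⟨a, h⟩)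
      ?_ ?_
    · intro f hf
      simp only [completePairs, mem_coe, mem_filter, mem_univ, true_and] at hf
      simp only [hPat, mem_coe, mem_filter, mem_univ, true_and]
      refine ⟨fun a => ?_, fun a b ha hb => ?_⟩
      · split_ifs with ha
        · exact hf.1 _
        · exact hf.2.1 _
      · rw [dif_pos ha, dif_neg hb]
        exact hf.2.2 _ _
    · intro f _ g _ hfg
      refine Prod.ext (funext fun a => ?_) (funext fun a => ?_)
      · have := congrFun hfg a.1
        simpa [a.2] using this
      · have := congrFun hfg a.1
        have h2 : ¬ c₀ a.1 = false := a.2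
        simpa only [dif_neg h2] using this
  have h2 := le_card_completePairs G P Q {a // c₀ a = false} {a // ¬ c₀ a = false} hd.le he
  rw [← hm] at h2
  have h3 : d ^ m * μ ^ h * (N : ℝ) ^ h ≤ ((univ.filter fun S => Pat S).card : ℝ) := by
    calc d ^ m * μ ^ h * (N : ℝ) ^ h = d ^ m *
          ((μ * N) ^ Fintype.card {a // c₀ a = false} *
            (μ * N) ^ Fintype.card {a // ¬ c₀ a = false}) := by
          rw [← pow_add, hcard, mul_pow]; ring
      _ ≤ _ := by gcongr
      _ ≤ _ := h2
      _ ≤ _ := by exact_mod_cast h1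
  obtain ⟨S, hS, hinj⟩ : ∃ S, Pat S ∧ Function.Injective S := by
    by_contra! hcon
    have h4 := card_mul_card_filter_le (V := V) (Fin.elim0 : Fin 0 → V) Pat
    rw [filter_false_of_mem (p := fun S => Pat S ∧ _) fun S _ hS => hcon S hS.1 hS.2.1,
      Fintype.card_fin, mul_zero, card_empty, mul_zero, zero_add, add_zero, ← hh, ← hNdef] at h4
    have h5 : (N : ℝ) * (univ.filter fun S => Pat S).card ≤ h ^ 2 * N ^ h := by exact_mod_cast h4
    have h6 : (N : ℝ) * (d ^ m * μ ^ h * (N : ℝ) ^ h) ≤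
        N * (univ.filter fun S => Pat S).card := by gcongr
    have h7 : (h : ℝ) ^ 2 * N ^ h < d ^ m * μ ^ h * N * N ^ h := by gcongr
    nlinarith
  rw [hPat] at hS
  obtain ⟨hS1, hS2⟩ := hS
  refine ⟨S, ⟨hinj, fun a b hab => ?_⟩, hS1⟩
  have hne := hc₀ hab
  cases ha : c₀ a <;> cases hb : c₀ b
  · exact absurd (ha.trans hb.symm) hne
  · exact hS2 a b ha (by simp [hb])
  · exact (hS2 b a hb (by simp [ha])).symm
  · exact absurd (ha.trans hb.symm) hne

/-- Greedy packing of copies of `H` into clusters. -/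
theorem exists_packing {ι : Type*} [Fintype ι] [Fintype V] {G : SimpleGraph V} {c₀ : α → Bool}
    {u w : ℕ} (hu : (univ.filter fun a => c₀ a = false).card = u)
    (hw : (univ.filter fun a => ¬ c₀ a = false).card = w) (K : ι → ℝ) (m : ℕ) :
    ∀ (p : ι → ι → ℕ) (C : ι → Finset V), ∑ x, ∑ y, p x y = m →
      (∀ x y, x ≠ y → Disjoint (C x) (C y)) →
      (∀ x y, p x y ≠ 0 → ∀ P ⊆ C x, ∀ Q ⊆ C y, K x ≤ P.card → K y ≤ Q.card →
        ∃ f : α → V, IsCopy H G f ∧ ∀ a, f a ∈ if c₀ a = false then P else Q) →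
      (∀ z, ((∑ y, (u * p z y + w * p y z) : ℕ) : ℝ) + K z ≤ (C z).card) →
      ∃ S ⊆ univ.biUnion C, Tileable H G S ∧ S.card = (u + w) * m := by
  induction m with
  | zero => exact fun p C _ _ _ _ => ⟨∅, empty_subset _, tileable_empty, by simp⟩
  | succ m ih =>
    intro p C hp hC hcopy hsize
    obtain ⟨x, -, hx⟩ := exists_ne_zero_of_sum_ne_zero (by rw [hp]; omega :
      ∑ x, ∑ y, p x y ≠ 0)
    obtain ⟨y, -, hxy⟩ := exists_ne_zero_of_sum_ne_zero hx
    have hK : ∀ z, K z ≤ (C z).card := fun z => by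
      have := hsize z
      have h0 : (0 : ℝ) ≤ ((∑ y, (u * p z y + w * p y z) : ℕ) : ℝ) := Nat.cast_nonneg _
      linarith
    obtain ⟨f, hf, hfm⟩ := hcopy x y hxy (C x) (Subset.refl _) (C y) (Subset.refl _) (hK x) (hK y)
    set p' : ι → ι → ℕ := fun a b => p a b - if a = x ∧ b = y then 1 else 0 with hp'
    have hpp : ∀ a b, p a b = p' a b + if a = x ∧ b = y then 1 else 0 := by
      intro a b
      simp only [hp']
      split_ifs with h
      · obtain ⟨rfl, rfl⟩ := h; omega
      · omega
    have hdel : ∑ a, ∑ b, (if a = x ∧ b = y then 1 else 0 : ℕ) = 1 := by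
      simp [ite_and]
    have hsum' : ∑ a, ∑ b, p' a b = m := by
      simp only [hpp, sum_add_distrib, hdel] at hp
      omega
    have h_int : ∀ z, (C z ∩ univ.image f).card ≤
        (if z = x then u else 0) + if z = y then w else 0 := by
      intro z
      have hsub : C z ∩ univ.image f ⊆
          (if z = x then (univ.filter fun a => c₀ a = false).image f else ∅) ∪
          if z = y then (univ.filter fun a => ¬ c₀ a = false).image f else ∅ := by
        intro v hv
        rw [mem_inter, mem_image] at hv
        obtain ⟨hvz, a, -, rfl⟩ := hv
        have h1 := hfm a
        rw [mem_union]
        by_cases ha : c₀ a = false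
        · rw [if_pos ha] at h1
          have hzx : z = x := by
            by_contra hne
            exact disjoint_left.1 (hC z x hne) hvz h1
          left
          rw [if_pos hzx]
          exact mem_image_of_mem _ (by simp [ha])
        · rw [if_neg ha] at h1
          have hzy : z = y := by
            by_contra hne
            exact disjoint_left.1 (hC z y hne) hvz h1
          right
          rw [if_pos hzy]
          exact mem_image_of_mem _ (mem_filter.2 ⟨mem_univ _, ha⟩)
      refine (card_le_card hsub).trans ((card_union_le _ _).trans (Nat.add_le_add ?_ ?_))
      · split_ifs
        · exact card_image_le.trans hu.le
        · simp
      · split_ifs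
        · exact card_image_le.trans hw.le
        · simp
    obtain ⟨S, hS, hSt, hSc⟩ := ih p' (fun z => C z \ univ.image f) hsum'
      (fun a b hab => (hC a b hab).mono sdiff_subset sdiff_subset)
      (fun a b hab P hP Q hQ => hcopy a b (by rw [hpp]; omega) P (hP.trans sdiff_subset) Q
        (hQ.trans sdiff_subset)) (fun z => by
          have h1 := hsize z
          have h2 := h_int z
          have h3 : ∑ b, (u * p z b + w * p b z) = ∑ b, (u * p' z b + w * p' b z) +
              ((if z = x then u else 0) + if z = y then w else 0) := by
            simp only [hpp, mul_add, sum_add_distrib, ite_and]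
            by_cases hzx : z = x <;> by_cases hzy : z = y <;> simp [hzx, hzy] <;> ring
          have h4 := card_sdiff_add_card_inter (C z) (univ.image f)
          have h5 : ((C z \ univ.image f).card : ℝ) + (C z ∩ univ.image f).card = (C z).card := by
            exact_mod_cast h4
          have h6 : ((C z ∩ univ.image f).card : ℝ) ≤
            (((if z = x then u else 0) + if z = y then w else 0 : ℕ) : ℝ) := by exact_mod_cast h2
          rw [h3, Nat.cast_add] at h1
          linarith)
    have hdis : Disjoint (univ.image f) S := by
      rw [disjoint_right]
      intro v hv
      obtain ⟨z, -, hz⟩ := mem_biUnion.1 (hS hv)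
      exact (mem_sdiff.1 hz).2
    refine ⟨univ.image f ∪ S, union_subset ?_ ?_, hf.tileable.union hSt hdis, ?_⟩
    · intro v hv
      obtain ⟨a, -, rfl⟩ := mem_image.1 hv
      have := hfm a
      rw [mem_biUnion]
      split_ifs at this
      · exact ⟨x, mem_univ _, this⟩
      · exact ⟨y, mem_univ _, this⟩
    · intro v hv
      obtain ⟨z, hz, hz'⟩ := mem_biUnion.1 (hS hv)
      exact mem_biUnion.2 ⟨z, hz, sdiff_subset hz'⟩
    · have h1 := card_filter_add_card_filter_not (s := (univ : Finset α)) fun a => c₀ a = false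
      rw [card_union_of_disjoint hdis, hSc, card_image_of_injective _ hf.1, ← h1, hu, hw]
      ring

end Embedding

/-! ### Regular clusters -/

/-- Every large subpair of `(A, B)` has almost the density of `(A, B)`. -/
def UniformPair (G : SimpleGraph V) (ε : ℝ) (A B : Finset V) : Prop :=
  ∀ S ⊆ A, ∀ T ⊆ B, ε * A.card ≤ S.card → ε * B.card ≤ T.card →
    |dens G S T - dens G A B| < ε

theorem dens_eq_edgeDensity (G : SimpleGraph V) (A B : Finset V) :
    dens G A B = (G.edgeDensity A B : ℝ) := by
  rw [dens, SimpleGraph.edgeDensity_def]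
  push_cast
  rfl

theorem uniformPair_iff_isUniform {G : SimpleGraph V} {ε : ℝ} {A B : Finset V} :
    UniformPair G ε A B ↔ G.IsUniform ε A B := by
  simp only [UniformPair, SimpleGraph.IsUniform, dens_eq_edgeDensity, mul_comm ε]

theorem UniformPair.le_eAB {θ ω : ℝ} (hθ : 0 < θ) (hθ1 : θ ≤ 1 / 4) (hω : 0 < ω)
    (hω1 : ω ≤ 1) {G : SimpleGraph V} {A B S T P Q : Finset V}
    (h : UniformPair G (ω * θ ^ 2) A B) (hSA : S ⊆ A) (hTB : T ⊆ B)
    (hS : θ * A.card ≤ S.card) (hT : θ * B.card ≤ T.card) (hS0 : (0 : ℝ) < S.card)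
    (hT0 : (0 : ℝ) < T.card) (hST : θ * (S.card * T.card) ≤ eAB G S T) (hP : P ⊆ S)
    (hQ : Q ⊆ T) (hPc : ω * S.card ≤ P.card) (hQc : ω * T.card ≤ Q.card) :
    θ / 2 * (P.card * Q.card) ≤ eAB G P Q := by
  have hPp : (0 : ℝ) < P.card := lt_of_lt_of_le (mul_pos hω hS0) hPc
  have hQp : (0 : ℝ) < Q.card := lt_of_lt_of_le (mul_pos hω hT0) hQc
  have hθ2 : θ ^ 2 ≤ θ := by nlinarith
  have small : ∀ t s : ℝ, 0 ≤ t → θ * t ≤ s → ω * θ ^ 2 * t ≤ ω * s := by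
    intro t s ht h
    rw [mul_assoc]
    exact mul_le_mul_of_nonneg_left ((mul_le_mul_of_nonneg_right hθ2 ht).trans h) hω.le
  have hle : ∀ s : ℝ, 0 ≤ s → ω * s ≤ s := fun s hs => mul_le_of_le_one_left hs hω1
  have hSs := small _ _ (Nat.cast_nonneg _) hS
  have hTs := small _ _ (Nat.cast_nonneg _) hT
  have d1 := abs_lt.1 (h P (hP.trans hSA) Q (hQ.trans hTB) (hSs.trans hPc) (hTs.trans hQc))
  have d2 := abs_lt.1 (h S hSA T hTB (hSs.trans (hle _ hS0.le)) (hTs.trans (hle _ hT0.le)))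
  have d3 : θ ≤ dens G S T := by
    rwa [dens, le_div_iff₀ (mul_pos hS0 hT0)]
  have d4 : ω * θ ^ 2 ≤ θ / 4 := by
    have : ω * θ ^ 2 ≤ 1 * θ ^ 2 := by gcongr
    nlinarith
  have d5 : θ / 2 ≤ dens G P Q := by linarith [d1.1, d2.2]
  rwa [dens, le_div_iff₀ (mul_pos hPp hQp)] at d5

theorem exists_uniform_partition {ε : ℝ} (hε : 0 < ε) (l : ℕ) (hl : 0 < l) :
    ∃ K : ℕ, ∀ (V : Type) [Fintype V] (G : SimpleGraph V), l ≤ Fintype.card V →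
      ∃ (ι : Type) (_ : Fintype ι) (B : ι → Finset V),
        (∀ i j, i ≠ j → Disjoint (B i) (B j)) ∧ univ.biUnion B = univ ∧
        l ≤ Fintype.card ι ∧ Fintype.card ι ≤ K ∧
        (∀ i, Fintype.card V ≤ 2 * Fintype.card ι * (B i).card) ∧
        (∀ i, Fintype.card ι * (B i).card ≤ 2 * Fintype.card V) ∧
        (∀ i j, UniformPair G ε (B i) (B j) → UniformPair G ε (B j) (B i)) ∧
        ((univ.filter fun p : ι × ι => p.1 ≠ p.2 ∧ ¬ UniformPair G ε (B p.1) (B p.2)).card : ℝ) ≤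
          ε * (Fintype.card ι : ℝ) ^ 2 := by
  refine ⟨SzemerediRegularity.bound ε l, fun V _ G hlV => ?_⟩
  obtain ⟨P, hP, hlP, hPb, hPu⟩ := szemeredi_regularity G hε hlV
  have hk : P.parts.card ≤ Fintype.card V := by
    simpa using P.card_parts_le_card
  have hk0 : 0 < P.parts.card := hl.trans_le hlP
  have hcard : Fintype.card P.parts = P.parts.card := Fintype.card_coe _
  refine ⟨P.parts, inferInstance, fun i => i.1, ?_, ?_, ?_, ?_, ?_, ?_, ?_, ?_⟩
  · intro i j hij
    exact P.disjoint i.2 j.2 fun h => hij (Subtype.ext h)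
  · ext x
    simp only [mem_biUnion, mem_univ, true_and, iff_true]
    obtain ⟨i, hi, hx⟩ := P.exists_mem (mem_univ x)
    exact ⟨⟨i, hi⟩, hx⟩
  · rwa [hcard]
  · rwa [hcard]
  · intro i
    have h1 := hP.average_le_card_part i.2
    rw [hcard]
    rw [card_univ] at h1
    have h2 := Nat.lt_mul_div_succ (Fintype.card V) hk0
    have h3 : 1 ≤ Fintype.card V / P.parts.card := (Nat.one_le_div_iff hk0).2 hk
    have h4 := Nat.mul_le_mul_left P.parts.card h1
    have h5 := Nat.mul_le_mul_left P.parts.card h3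
    nlinarith
  · intro i
    have h1 := hP.card_part_le_average_add_one i.2
    rw [hcard]
    rw [card_univ] at h1
    have h2 := Nat.mul_div_le (Fintype.card V) P.parts.card
    have h4 := Nat.mul_le_mul_left P.parts.card h1
    nlinarith
  · intro i j h
    rw [uniformPair_iff_isUniform] at h ⊢
    exact h.symm
  · rw [hcard]
    have h1 : (univ.filter fun p : P.parts × P.parts =>
        p.1 ≠ p.2 ∧ ¬ UniformPair G ε p.1.1 p.2.1).card ≤ (P.nonUniforms G ε).card := by
      refine card_le_card_of_injOn (fun p => (p.1.1, p.2.1)) ?_ ?_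
      · intro p hp
        simp only [coe_filter, mem_univ, true_and, Set.mem_ofPred_eq] at hp
        rw [mem_coe, Finpartition.mk_mem_nonUniforms]
        exact ⟨p.1.2, p.2.2, fun h => hp.1 (Subtype.ext h), fun h =>
          hp.2 (uniformPair_iff_isUniform.2 h)⟩
      · intro p _ q _ h
        simp only [Prod.mk.injEq] at h
        exact Prod.ext (Subtype.ext h.1) (Subtype.ext h.2)
    have h2 : ((P.parts.card * (P.parts.card - 1) : ℕ) : ℝ) ≤ (P.parts.card : ℝ) ^ 2 := by
      rw [sq]
      exact_mod_cast Nat.mul_le_mul_left _ (Nat.sub_le _ _)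
    calc _ ≤ ((P.nonUniforms G ε).card : ℝ) := by exact_mod_cast h1
      _ ≤ (P.parts.card * (P.parts.card - 1) : ℕ) * ε := hPu
      _ ≤ (P.parts.card : ℝ) ^ 2 * ε := by gcongr
      _ = _ := mul_comm _ _

theorem eAB_le_card_mul_card (G : SimpleGraph V) (A B : Finset V) :
    eAB G A B ≤ A.card * B.card :=
  (card_filter_le _ _).trans (card_product A B).le

theorem sum_filter_snd_eq {ι M : Type*} [Fintype ι] [AddCommMonoid M] (b : Bool)
    (f : ι × Bool → M) : ∑ y with y.2 = b, f y = ∑ i, f (i, b) := by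
  rw [sum_filter, Fintype.sum_prod_type]
  simp

theorem exists_clusters_of_partition {θ ω : ℝ} (hθ : 0 < θ) (hθ1 : θ ≤ 1 / 4) (hω : 0 < ω)
    (hω1 : ω ≤ 1) [Fintype V] (G : SimpleGraph V) (Z : Bool → Finset V) (n : ℕ)
    (hN : Fintype.card V = 2 * n) (hZ : ∀ b, (Z b).card ≤ n)
    (hZd : Disjoint (Z false) (Z true)) {ι : Type*} [Fintype ι] (B : ι → Finset V)
    (hB : ∀ i j, i ≠ j → Disjoint (B i) (B j)) (hBu : univ.biUnion B = univ)
    (hk : 4 / θ ≤ Fintype.card ι)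
    (hlow : ∀ i, Fintype.card V ≤ 2 * Fintype.card ι * (B i).card)
    (hupp : ∀ i, Fintype.card ι * (B i).card ≤ 2 * Fintype.card V)
    (hsymm : ∀ i j, UniformPair G (ω * θ ^ 2) (B i) (B j) → UniformPair G (ω * θ ^ 2) (B j) (B i))
    (hunif : ((univ.filter fun p : ι × ι =>
      p.1 ≠ p.2 ∧ ¬ UniformPair G (ω * θ ^ 2) (B p.1) (B p.2)).card : ℝ) ≤
        ω * θ ^ 2 * (Fintype.card ι : ℝ) ^ 2) :
    ∃ (C : ι × Bool → Finset V) (R : ι × Bool → ι × Bool → Prop),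
      (∀ x y, x ≠ y → Disjoint (C x) (C y)) ∧ (∀ z, C z ⊆ Z z.2) ∧ (∀ x y, R x y → R y x) ∧
      (∀ x y, R x y → x.2 = !y.2) ∧
      (∀ x y, R x y → θ / (2 * Fintype.card ι) * Fintype.card V ≤ (C x).card ∧
        ∀ P ⊆ C x, ∀ Q ⊆ C y, ω * (C x).card ≤ P.card → ω * (C y).card ≤ Q.card →
          θ / 2 * (P.card * Q.card) ≤ eAB G P Q) ∧
      (∀ b, ((Z b).card : ℝ) ≤ ∑ z with z.2 = b, ((C z).card : ℝ) + 6 * θ * n) ∧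
      ∀ x, ∑ y with y.2 = !x.2 ∧ ¬ R x y, (eAB G (C x) (C y) : ℝ) ≤ 6 * θ * n * (C x).card := by
  have hkp : (0 : ℝ) < Fintype.card ι := lt_of_lt_of_le (by positivity) hk
  have hNr : (Fintype.card V : ℝ) = 2 * n := by exact_mod_cast hN
  generalize hkdef : (Fintype.card ι : ℝ) = k at *
  have hupp' : ∀ i, ((B i).card : ℝ) ≤ 4 * n / k := by
    intro i
    have : k * (B i).card ≤ 2 * (Fintype.card V : ℝ) := by
      rw [← hkdef]; exact_mod_cast hupp i
    rw [le_div_iff₀ hkp]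
    linarith
  have hpart : 0 ≤ 4 * (n : ℝ) / k := by positivity
  obtain ⟨U, hU⟩ : ∃ U : ι → ι → Prop, U = fun i j => UniformPair G (ω * θ ^ 2) (B i) (B j) :=
    ⟨_, rfl⟩
  obtain ⟨bad, hbad⟩ : ∃ bad : ι → Prop, bad = fun i =>
      θ * k < ((univ.filter fun j => i ≠ j ∧ ¬ U i j).card : ℝ) := ⟨_, rfl⟩
  have hUs : ∀ i j, U i j → U j i := by
    subst hU; exact hsymm
  have hbadcard : ((univ.filter bad).card : ℝ) ≤ θ * k := by
    have h1 : ((univ.filter bad).card : ℝ) * (θ * k) ≤ ω * θ ^ 2 * k ^ 2 := by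
      refine le_trans ?_ hunif
      have h2 : (univ.filter fun p : ι × ι =>
          p.1 ≠ p.2 ∧ ¬ UniformPair G (ω * θ ^ 2) (B p.1) (B p.2)).card =
          ∑ i, (univ.filter fun j => i ≠ j ∧ ¬ U i j).card := by
        subst hU
        simp only [card_filter, Fintype.sum_prod_type]
      rw [h2, ← nsmul_eq_mul]
      push_cast
      refine (card_nsmul_le_sum (univ.filter bad) _ _ fun i hi => ?_).trans
        (sum_le_univ_sum_of_nonneg fun i => Nat.cast_nonneg _)
      have := (mem_filter.1 hi).2
      rw [hbad] at this
      exact this.le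
    have h3 : ω * θ ^ 2 * k ^ 2 ≤ θ * k * (θ * k) := by
      nlinarith [mul_le_mul_of_nonneg_right hω1 (sq_nonneg (θ * k))]
    exact le_of_mul_le_mul_right (h1.trans h3) (by positivity)
  have hbadn : ∀ i, ¬ bad i → ((univ.filter fun j => i ≠ j ∧ ¬ U i j).card : ℝ) ≤ θ * k := by
    intro i hi
    rw [hbad] at hi
    exact not_lt.1 hi
  obtain ⟨C, hC⟩ : ∃ C : ι × Bool → Finset V, C = fun x =>
      if ¬ bad x.1 ∧ θ * (B x.1).card ≤ ((B x.1 ∩ Z x.2).card : ℝ) then B x.1 ∩ Z x.2 else ∅ :=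
    ⟨_, rfl⟩
  have hCsub : ∀ x, C x ⊆ B x.1 ∩ Z x.2 := by
    intro x
    rw [hC]
    dsimp only
    split_ifs
    · exact Subset.rfl
    · exact empty_subset _
  have hCne : ∀ x, (C x).Nonempty → ¬ bad x.1 ∧ θ * (B x.1).card ≤ ((C x).card : ℝ) := by
    intro x hx
    by_cases h : ¬ bad x.1 ∧ θ * (B x.1).card ≤ ((B x.1 ∩ Z x.2).card : ℝ)
    · have : C x = B x.1 ∩ Z x.2 := by rw [hC]; exact if_pos h
      rwa [this]
    · have : C x = ∅ := by rw [hC]; exact if_neg h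
      simp [this] at hx
  have hCloss : ∀ x, ((B x.1 ∩ Z x.2).card : ℝ) ≤
      (C x).card + (θ * (B x.1).card + if bad x.1 then ((B x.1).card : ℝ) else 0) := by
    intro x
    have hle : ((B x.1 ∩ Z x.2).card : ℝ) ≤ (B x.1).card := by
      exact_mod_cast card_le_card inter_subset_left
    have h0 : 0 ≤ θ * ((B x.1).card : ℝ) := mul_nonneg hθ.le (Nat.cast_nonneg _)
    have h1 : (0 : ℝ) ≤ (C x).card := Nat.cast_nonneg _
    by_cases hb : bad x.1
    · rw [if_pos hb]; linarith
    · rw [if_neg hb]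
      by_cases h : θ * (B x.1).card ≤ ((B x.1 ∩ Z x.2).card : ℝ)
      · have : C x = B x.1 ∩ Z x.2 := by rw [hC]; exact if_pos ⟨hb, h⟩
        rw [this]; linarith
      · push Not at h
        linarith
  have hCdisj : ∀ x y, x ≠ y → Disjoint (C x) (C y) := by
    intro x y hxy
    refine disjoint_of_subset_left (hCsub x) (disjoint_of_subset_right (hCsub y) ?_)
    by_cases h : x.1 = y.1
    · have h2 : x.2 ≠ y.2 := fun h2 => hxy (Prod.ext h h2)
      refine disjoint_of_subset_left inter_subset_right
        (disjoint_of_subset_right inter_subset_right ?_)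
      cases hx : x.2 <;> cases hy : y.2
      · simp [hx, hy] at h2
      · exact hZd
      · exact hZd.symm
      · simp [hx, hy] at h2
    · exact disjoint_of_subset_left inter_subset_left
        (disjoint_of_subset_right inter_subset_left (hB _ _ h))
  have hsumB : ∑ i, ((B i).card : ℝ) = 2 * n := by
    rw [← hNr, ← card_univ, ← hBu, card_biUnion fun i _ j _ h => hB i j h]
    push_cast; rfl
  have hsumZ : ∀ b, ∑ i, ((B i ∩ Z b).card : ℝ) = (Z b).card := by
    intro b
    have : (Z b) = univ.biUnion fun i => B i ∩ Z b := by
      rw [← Finset.biUnion_inter, hBu, univ_inter]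
    conv_rhs => rw [this]
    rw [card_biUnion fun i _ j _ h => disjoint_of_subset_left inter_subset_left
        (disjoint_of_subset_right inter_subset_left (hB _ _ h))]
    push_cast; rfl
  obtain ⟨R, hR⟩ : ∃ R : ι × Bool → ι × Bool → Prop, R = fun x y =>
      x.2 = (!y.2) ∧ x.1 ≠ y.1 ∧ U x.1 y.1 ∧ (C x).Nonempty ∧ (C y).Nonempty ∧
        θ * ((C x).card * (C y).card) ≤ eAB G (C x) (C y) := ⟨_, rfl⟩
  refine ⟨C, R, hCdisj, fun z => (hCsub z).trans inter_subset_right, ?_, ?_, ?_, ?_, ?_⟩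
  · subst hR
    rintro x y ⟨h1, h2, h3, h4, h5, h6⟩
    refine ⟨by simp [h1], h2.symm, hUs _ _ h3, h5, h4, ?_⟩
    rw [eAB_comm G (C y), mul_comm ((C y).card : ℝ)]
    exact h6
  · subst hR
    exact fun x y h => h.1
  · subst hR
    rintro x y ⟨h1, h2, h3, h4, h5, h6⟩
    have hx := hCne x h4
    have hy := hCne y h5
    have hxp : (0 : ℝ) < (C x).card := by exact_mod_cast h4.card_pos
    have hyp : (0 : ℝ) < (C y).card := by exact_mod_cast h5.card_pos
    refine ⟨?_, ?_⟩
    · have h7 : (Fintype.card V : ℝ) ≤ 2 * k * (B x.1).card := by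
        rw [← hkdef]; exact_mod_cast hlow x.1
      refine le_trans ?_ hx.2
      rw [div_mul_eq_mul_div, div_le_iff₀ (by positivity)]
      nlinarith
    · intro P hP Q hQ hPc hQc
      rw [hU] at h3
      exact h3.le_eAB hθ hθ1 hω hω1 ((hCsub x).trans inter_subset_left)
        ((hCsub y).trans inter_subset_left) hx.2 hy.2 hxp hyp h6 hP hQ hPc hQc
  · intro b
    rw [sum_filter_snd_eq, ← hsumZ b]
    have h1 : ∑ i, ((B i ∩ Z b).card : ℝ) ≤ ∑ i, ((C (i, b)).card : ℝ) +
        (θ * ∑ i, ((B i).card : ℝ) + ∑ i, if bad i then ((B i).card : ℝ) else 0) := by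
      rw [mul_sum, ← sum_add_distrib, ← sum_add_distrib]
      exact sum_le_sum fun i _ => hCloss (i, b)
    have h2 : ∑ i, (if bad i then ((B i).card : ℝ) else 0) ≤ θ * (4 * n) := by
      rw [← sum_filter]
      calc _ ≤ ((univ.filter bad).card : ℝ) * (4 * n / k) := by
            rw [← nsmul_eq_mul]
            exact sum_le_card_nsmul _ _ _ fun i _ => hupp' i
        _ ≤ θ * k * (4 * n / k) := mul_le_mul_of_nonneg_right hbadcard hpart
        _ = _ := by field_simp
    rw [hsumB] at h1
    linarith
  · intro x
    rcases (C x).eq_empty_or_nonempty with hx | hx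
    · simp [hx, eAB]
    have hxn := hbadn x.1 (hCne x hx).1
    have h1 : ∀ y, y.2 = !x.2 → ¬ R x y → (eAB G (C x) (C y) : ℝ) ≤ (C x).card *
        ((if x.1 = y.1 then ((B y.1).card : ℝ) else 0) +
          (if x.1 ≠ y.1 ∧ ¬ U x.1 y.1 then ((B y.1).card : ℝ) else 0) + θ * (C y).card) := by
      intro y hy hxy
      have e1 : (eAB G (C x) (C y) : ℝ) ≤ (C x).card * (C y).card := by
        exact_mod_cast eAB_le_card_mul_card G _ _
      have e2 : ((C y).card : ℝ) ≤ (B y.1).card := by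
        exact_mod_cast card_le_card ((hCsub y).trans inter_subset_left)
      have e0 : (0 : ℝ) ≤ θ * (C y).card := mul_nonneg hθ.le (Nat.cast_nonneg _)
      have e3 : (eAB G (C x) (C y) : ℝ) ≤ (C x).card * ((B y.1).card : ℝ) :=
        e1.trans (mul_le_mul_of_nonneg_left e2 (Nat.cast_nonneg _))
      by_cases h : x.1 = y.1
      · rw [if_pos h, if_neg (by simp [h]), add_zero]
        exact e3.trans (mul_le_mul_of_nonneg_left (by linarith) (Nat.cast_nonneg _))
      · rw [if_neg h]
        by_cases h' : U x.1 y.1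
        · rw [if_neg (by simp [h']), add_zero, zero_add]
          rcases (C y).eq_empty_or_nonempty with hy' | hy'
          · simp [hy', eAB]
          · rw [hR] at hxy
            have : ¬ θ * ((C x).card * (C y).card) ≤ (eAB G (C x) (C y) : ℝ) := fun hh =>
              hxy ⟨by simp [hy], h, h', hx, hy', hh⟩
            push Not at this
            linarith
        · rw [if_pos ⟨h, h'⟩, zero_add]
          exact e3.trans (mul_le_mul_of_nonneg_left (by linarith) (Nat.cast_nonneg _))
    have h2 : ∑ y with y.2 = !x.2 ∧ ¬ R x y, (eAB G (C x) (C y) : ℝ) ≤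
        ∑ y with y.2 = !x.2, (C x).card *
        ((if x.1 = y.1 then ((B y.1).card : ℝ) else 0) +
          (if x.1 ≠ y.1 ∧ ¬ U x.1 y.1 then ((B y.1).card : ℝ) else 0) + θ * (C y).card) := by
      refine (sum_le_sum fun y hy => h1 y (mem_filter.1 hy).2.1 (mem_filter.1 hy).2.2).trans ?_
      refine sum_le_sum_of_subset_of_nonneg ?_ fun y _ _ =>
        mul_nonneg (Nat.cast_nonneg _) (add_nonneg (add_nonneg ?_ ?_)
          (mul_nonneg hθ.le (Nat.cast_nonneg _)))
      · exact fun y hy => mem_filter.2 ⟨mem_univ _, (mem_filter.1 hy).2.1⟩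
      · split_ifs <;> simp
      · split_ifs <;> simp
    refine h2.trans ?_
    rw [sum_filter_snd_eq, ← mul_sum, sum_add_distrib, sum_add_distrib]
    dsimp only
    have t1 : ∑ i, (if x.1 = i then ((B i).card : ℝ) else 0) ≤ θ * n := by
      rw [sum_ite_eq]
      simp only [mem_univ, if_true]
      refine (hupp' x.1).trans ?_
      rw [div_le_iff₀ hkp]
      rw [div_le_iff₀ hθ] at hk
      nlinarith
    have t2 : ∑ i, (if x.1 ≠ i ∧ ¬ U x.1 i then ((B i).card : ℝ) else 0) ≤ θ * (4 * n) := by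
      rw [← sum_filter]
      calc _ ≤ ((univ.filter fun j => x.1 ≠ j ∧ ¬ U x.1 j).card : ℝ) * (4 * n / k) := by
            rw [← nsmul_eq_mul]
            exact sum_le_card_nsmul _ _ _ fun i _ => hupp' i
        _ ≤ θ * k * (4 * n / k) := mul_le_mul_of_nonneg_right hxn hpart
        _ = _ := by field_simp
    have t3 : ∑ i, θ * ((C (i, !x.2)).card : ℝ) ≤ θ * n := by
      rw [← mul_sum]
      gcongr
      refine le_trans (sum_le_sum (g := fun i => ((B i ∩ Z (!x.2)).card : ℝ)) fun i _ => ?_) ?_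
      · exact_mod_cast card_le_card (hCsub (i, !x.2))
      · rw [hsumZ]
        exact_mod_cast hZ _
    rw [mul_comm (6 * θ * (n : ℝ))]
    exact mul_le_mul_of_nonneg_left (by linarith) (Nat.cast_nonneg _)

theorem exists_clusters {θ ω : ℝ} (hθ : 0 < θ) (hθ1 : θ ≤ 1 / 4) (hω : 0 < ω) (hω1 : ω ≤ 1) :
    ∃ K : ℕ, ∃ κ : ℝ, 0 < κ ∧ ∃ n₁ : ℕ, ∀ (V : Type) [Fintype V] (G : SimpleGraph V)
      (Z : Bool → Finset V) (n : ℕ), n₁ ≤ n → Fintype.card V = 2 * n →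
      (∀ b, (Z b).card ≤ n) → Disjoint (Z false) (Z true) →
      ∃ (ι : Type) (_ : Fintype ι) (side : ι → Bool) (C : ι → Finset V) (R : ι → ι → Prop),
        Fintype.card ι ≤ K ∧
        (∀ x y, x ≠ y → Disjoint (C x) (C y)) ∧ (∀ z, C z ⊆ Z (side z)) ∧
        (∀ x y, R x y → R y x) ∧ (∀ x y, R x y → side x = !side y) ∧
        (∀ x y, R x y → κ * Fintype.card V ≤ (C x).card ∧
          ∀ P ⊆ C x, ∀ Q ⊆ C y, ω * (C x).card ≤ P.card → ω * (C y).card ≤ Q.card →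
            θ / 2 * (P.card * Q.card) ≤ eAB G P Q) ∧
        (∀ b, ((Z b).card : ℝ) ≤ ∑ z with side z = b, ((C z).card : ℝ) + 6 * θ * n) ∧
        ∀ x, ∑ y with side y = !side x ∧ ¬ R x y, (eAB G (C x) (C y) : ℝ) ≤
          6 * θ * n * (C x).card := by
  have hl : 0 < ⌈4 / θ⌉₊ := Nat.ceil_pos.2 (by positivity)
  obtain ⟨K, hK⟩ := exists_uniform_partition (ε := ω * θ ^ 2) (by positivity) _ hl
  refine ⟨2 * K, θ / (2 * (K + 1)), by positivity, ⌈4 / θ⌉₊, ?_⟩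
  intro V _ G Z n hn hN hZ hZd
  obtain ⟨ι, _, B, hB, hBu, hk, hkK, hlow, hupp, hsymm, hunif⟩ := hK V G (by omega)
  have hk' : 4 / θ ≤ Fintype.card ι := (Nat.le_ceil _).trans (by exact_mod_cast hk)
  obtain ⟨C, R, h1, h2, h3, h4, h5, h6, h7⟩ := exists_clusters_of_partition hθ hθ1 hω hω1 G Z n
    hN hZ hZd B hB hBu hk' hlow hupp hsymm hunif
  refine ⟨ι × Bool, inferInstance, Prod.snd, C, R, ?_, h1, h2, h3, h4, ?_, h6, h7⟩
  · rw [Fintype.card_prod, Fintype.card_bool]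
    omega
  · intro x y hxy
    refine ⟨le_trans ?_ (h5 x y hxy).1, (h5 x y hxy).2⟩
    have : (0 : ℝ) < Fintype.card ι := lt_of_lt_of_le (by positivity) hk'
    have : (Fintype.card ι : ℝ) ≤ K := by exact_mod_cast hkK
    gcongr
    linarith

/-! ### Almost perfect tilings -/

theorem eAB_eq_sum_ite (G : SimpleGraph V) (A B : Finset V) :
    eAB G A B = ∑ x ∈ A, ∑ y ∈ B, if G.Adj x y then 1 else 0 := by
  rw [eAB, card_filter, sum_product]

theorem eAB_biUnion_right {ι : Type*} (G : SimpleGraph V) (A : Finset V) (s : Finset ι)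
    (C : ι → Finset V) (hC : ∀ x ∈ s, ∀ y ∈ s, x ≠ y → Disjoint (C x) (C y)) :
    eAB G A (s.biUnion C) = ∑ y ∈ s, eAB G A (C y) := by
  simp only [eAB_eq_sum_ite]
  rw [sum_comm (s := s)]
  exact sum_congr rfl fun x _ => sum_biUnion fun i hi j hj h => hC i hi j hj h

theorem eAB_biUnion_left {ι : Type*} (G : SimpleGraph V) (B : Finset V) (s : Finset ι)
    (C : ι → Finset V) (hC : ∀ x ∈ s, ∀ y ∈ s, x ≠ y → Disjoint (C x) (C y)) :
    eAB G (s.biUnion C) B = ∑ y ∈ s, eAB G (C y) B := by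
  simp only [eAB_comm G _ B]
  exact eAB_biUnion_right G B s C hC

theorem eAB_le_add_sdiff (G : SimpleGraph V) {A B U : Finset V} (hU : U ⊆ B) :
    eAB G A B ≤ eAB G A U + A.card * (B \ U).card := by
  have : eAB G A B = eAB G A U + eAB G A (B \ U) := by
    simp only [eAB_eq_sum_ite, ← sum_add_distrib]
    refine sum_congr rfl fun x _ => ?_
    rw [add_comm]
    exact (sum_sdiff hU).symm
  rw [this]
  exact Nat.add_le_add_left (eAB_le_card_mul_card _ _ _) _

section Clusters

variable {G : SimpleGraph V} {Z : Bool → Finset V} {n : ℕ} {ι : Type*}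
  {side : ι → Bool} {C : ι → Finset V} {R : ι → ι → Prop} {θ : ℝ}

theorem card_biUnion_clusters (hCd : ∀ x y, x ≠ y → Disjoint (C x) (C y)) (s : Finset ι) :
    ((s.biUnion C).card : ℝ) = ∑ x ∈ s, ((C x).card : ℝ) := by
  rw [card_biUnion fun x _ y _ h => hCd x y h]
  push_cast
  rfl

theorem biUnion_clusters_subset (hCZ : ∀ z, C z ⊆ Z (side z)) {b : Bool} {s : Finset ι}
    (hs : ∀ x ∈ s, side x = b) : s.biUnion C ⊆ Z b :=
  biUnion_subset.2 fun x hx => hs x hx ▸ hCZ x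

variable [Fintype ι]

/-- Each cluster whose vertices have large degree has many neighbouring clusters. -/
theorem le_sum_card_neighbor_clusters (hCd : ∀ x y, x ≠ y → Disjoint (C x) (C y))
    (hCZ : ∀ z, C z ⊆ Z (side z))
    (hloss : ∀ b, ((Z b).card : ℝ) ≤ ∑ z with side z = b, ((C z).card : ℝ) + 6 * θ * n)
    (hnon : ∀ x, ∑ y with side y = !side x ∧ ¬ R x y, (eAB G (C x) (C y) : ℝ) ≤
      6 * θ * n * (C x).card) {D : ℝ} {x : ι} (hx : (C x).Nonempty)
    (hdeg : ∀ v ∈ C x, D ≤ degIn G v (Z (!side x))) :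
    D - 12 * θ * n ≤ ∑ y with side y = !side x ∧ R x y, ((C y).card : ℝ) := by
  have hxp : (0 : ℝ) < (C x).card := by exact_mod_cast hx.card_pos
  set s : Finset ι := univ.filter fun y => side y = !side x with hs
  have hUZ : s.biUnion C ⊆ Z (!side x) :=
    biUnion_clusters_subset hCZ fun y hy => (mem_filter.1 hy).2
  have h1 : D * (C x).card ≤ eAB G (C x) (Z (!side x)) := by
    rw [eAB_eq_sum_degIn, mul_comm, ← nsmul_eq_mul]
    push_cast
    exact card_nsmul_le_sum _ _ _ hdeg
  have h2 : (eAB G (C x) (Z (!side x)) : ℝ) ≤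
      ∑ y ∈ s, (eAB G (C x) (C y) : ℝ) + (C x).card * (6 * θ * n) := by
    have h3 : (eAB G (C x) (Z (!side x)) : ℝ) ≤
        eAB G (C x) (s.biUnion C) + (C x).card * ((Z (!side x) \ s.biUnion C).card : ℝ) := by
      exact_mod_cast eAB_le_add_sdiff G hUZ
    rw [eAB_biUnion_right G (C x) s C fun x _ y _ h => hCd x y h] at h3
    push_cast at h3
    refine h3.trans (add_le_add_right (mul_le_mul_of_nonneg_left ?_ hxp.le) _)
    have h4 : ((Z (!side x) \ s.biUnion C).card : ℝ) + (s.biUnion C).card =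
        (Z (!side x)).card := by
      exact_mod_cast card_sdiff_add_card_eq_card hUZ
    have := hloss (!side x)
    rw [card_biUnion_clusters hCd] at h4
    linarith
  have h5 : ∑ y ∈ s, (eAB G (C x) (C y) : ℝ) =
      ∑ y with side y = !side x ∧ R x y, (eAB G (C x) (C y) : ℝ) +
      ∑ y with side y = !side x ∧ ¬ R x y, (eAB G (C x) (C y) : ℝ) := by
    rw [← sum_filter_add_sum_filter_not s (fun y => R x y), hs, filter_filter, filter_filter]
  have h6 : ∑ y with side y = !side x ∧ R x y, (eAB G (C x) (C y) : ℝ) ≤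
      (C x).card * ∑ y with side y = !side x ∧ R x y, ((C y).card : ℝ) := by
    rw [mul_sum]
    exact sum_le_sum fun y _ => by exact_mod_cast eAB_le_card_mul_card G _ _
  have h7 := hnon x
  refine le_of_mul_le_mul_left ?_ hxp
  linarith

/-- The obstruction to a fractional tiling of the clusters yields a sparse pair. -/
theorem exists_sparse_pair (hCd : ∀ x y, x ≠ y → Disjoint (C x) (C y))
    (hCZ : ∀ z, C z ⊆ Z (side z)) (hR : ∀ x y, R x y → R y x)
    (hloss : ∀ b, ((Z b).card : ℝ) ≤ ∑ z with side z = b, ((C z).card : ℝ) + 6 * θ * n)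
    (hnon : ∀ x, ∑ y with side y = !side x ∧ ¬ R x y, (eAB G (C x) (C y) : ℝ) ≤
      6 * θ * n * (C x).card)
    (hθ : 0 < θ) {u w : ℕ} (hu : 1 ≤ u) (huw : u < w) {γ c : ℝ} (hγ : 0 < γ)
    (hc : (u + w) * (γ + 12 * θ) ≤ c) (hc1 : (u + w) * (γ + 12 * θ) < 1) (hn : 0 < n)
    (hZl : ∀ b, (1 - γ) * n ≤ (Z b).card) (hZu : ∀ b, (Z b).card ≤ n)
    (hdeg : ∀ b, ∀ v ∈ Z b, ((u : ℝ) / (u + w : ℕ) - γ) * n ≤ degIn G v (Z (!b)))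
    {b : Bool} {A B : Finset ι} (hA : ∀ x ∈ A, side x = b) (hB : ∀ x ∈ B, side x = !b)
    (hAB : ∀ x ∈ A, ∀ y ∈ B, ¬ R x y)
    (hlt : (w : ℝ) * (∑ x with side x = !b, ((C x).card : ℝ) - ∑ x ∈ B, ((C x).card : ℝ)) <
      u * ∑ x ∈ A, ((C x).card : ℝ)) :
    ∃ A' ⊆ Z b, ∃ B' ⊆ Z (!b), ((w : ℝ) / (u + w : ℕ) - c) * n ≤ A'.card ∧
      ((w : ℝ) / (u + w : ℕ) - c) * n ≤ B'.card ∧ (eAB G A' B' : ℝ) ≤ c * (n : ℝ) ^ 2 := by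
  have hu' : (1 : ℝ) ≤ u := by exact_mod_cast hu
  have huw' : (u : ℝ) + 1 ≤ w := by exact_mod_cast huw
  have hn' : (0 : ℝ) < n := by exact_mod_cast hn
  have hA' := biUnion_clusters_subset hCZ hA
  have hB' := biUnion_clusters_subset hCZ hB
  have hcA := card_biUnion_clusters hCd A
  have hcB := card_biUnion_clusters hCd B
  have hAn : ((A.biUnion C).card : ℝ) ≤ n := by
    exact_mod_cast (card_le_card hA').trans (hZu b)
  have hBn : ((B.biUnion C).card : ℝ) ≤ n := by
    exact_mod_cast (card_le_card hB').trans (hZu (!b))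
  have hk : ∀ b', ∑ x with side x = b', ((C x).card : ℝ) ≤ n := by
    intro b'
    rw [← card_biUnion_clusters hCd]
    exact_mod_cast (card_le_card (biUnion_clusters_subset hCZ fun x hx =>
      (mem_filter.1 hx).2)).trans (hZu b')
  have hBk : ∑ x ∈ B, ((C x).card : ℝ) ≤ ∑ x with side x = !b, ((C x).card : ℝ) :=
    sum_le_sum_of_subset_of_nonneg (fun x hx => mem_filter.2 ⟨mem_univ _, hB x hx⟩)
      fun _ _ _ => Nat.cast_nonneg _
  have hnbr : ∀ (b' : Bool) (T : Finset ι) (x : ι), side x = b' → (C x).Nonempty →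
      (∀ y ∈ T, side y = !b') → (∀ y ∈ T, ¬ R x y) →
      ((u : ℝ) / (u + w : ℕ) - γ) * n - 12 * θ * n ≤
        ∑ y with side y = !b', ((C y).card : ℝ) - ∑ y ∈ T, ((C y).card : ℝ) := by
    rintro b' T x rfl hxne hT hTR
    refine (le_sum_card_neighbor_clusters hCd hCZ hloss hnon hxne fun v hv =>
      hdeg _ v (hCZ x hv)).trans ?_
    rw [le_sub_iff_add_le, ← sum_union]
    · refine sum_le_sum_of_subset_of_nonneg (fun y hy => ?_) fun _ _ _ => Nat.cast_nonneg _
      rcases mem_union.1 hy with h | h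
      · exact mem_filter.2 ⟨mem_univ _, (mem_filter.1 h).2.1⟩
      · exact mem_filter.2 ⟨mem_univ _, hT y h⟩
    · rw [disjoint_left]
      exact fun y hy hy' => hTR y hy' (mem_filter.1 hy).2.2
  have hne : ∀ T : Finset ι, 0 < ∑ x ∈ T, ((C x).card : ℝ) → ∃ x ∈ T, (C x).Nonempty := by
    intro T hT
    by_contra! h
    exact hT.ne' (sum_eq_zero fun x hx => by simp [h x hx])
  rw [← hcA] at hlt
  rw [← hcB] at hlt hBk
  have hpos : (0 : ℝ) < (A.biUnion C).card := by
    by_contra! h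
    nlinarith
  obtain ⟨x, hxA, hx⟩ := hne A (hcA ▸ hpos)
  have hD1 := hnbr b B x (hA x hxA) hx hB fun y hy => hAB x hxA y hy
  rw [← hcB] at hD1
  have hl := hloss (!b)
  have hzl := hZl (!b)
  have hkb := hk (!b)
  generalize ∑ x with side x = !b, ((C x).card : ℝ) = kb at *
  have hpB : (0 : ℝ) < (B.biUnion C).card := by
    by_contra! h
    have h0 : ((B.biUnion C).card : ℝ) = 0 := le_antisymm h (Nat.cast_nonneg _)
    rw [h0, sub_zero] at hlt
    have e1 : (w : ℝ) * ((1 - γ - 6 * θ) * n) < u * n := by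
      refine lt_of_le_of_lt ?_ (lt_of_lt_of_le hlt ?_)
      · gcongr
        linarith
      · gcongr
    have e2 : (w : ℝ) * (1 - γ - 6 * θ) < u := by
      refine lt_of_mul_lt_mul_right (a := (n : ℝ)) ?_ hn'.le
      linarith
    nlinarith
  obtain ⟨y, hyB, hy⟩ := hne B (hcB ▸ hpB)
  have hD2 := hnbr (!b) A y (hB y hyB) hy (by simpa using hA) fun x hx h => hAB x hx y hyB (hR _ _ h)
  rw [Bool.not_not, ← hcA] at hD2
  have hka := hk b
  generalize ∑ x with side x = b, ((C x).card : ℝ) = ka at *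
  have hh : (0 : ℝ) < (u : ℝ) + w := by linarith
  have he : 0 < γ + 12 * θ := by linarith
  have hwe : (γ + 12 * θ) ≤ u * (γ + 12 * θ) := le_mul_of_one_le_left he.le hu'
  have hwc : (u : ℝ) * (γ + 12 * θ) ≤ w * (γ + 12 * θ) :=
    mul_le_mul_of_nonneg_right (by linarith) he.le
  have hcu : c ≤ u * c := le_mul_of_one_le_left (by linarith) hu'
  have hsplit : (u : ℝ) / (u + w : ℕ) = 1 - (w : ℝ) / (u + w : ℕ) := by
    push_cast
    field_simp
    ring
  have hwu : (u : ℝ) * ((w : ℝ) / (u + w : ℕ)) = w * ((u : ℝ) / (u + w : ℕ)) := by ring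
  generalize (w : ℝ) / (u + w : ℕ) = q at *
  generalize (u : ℝ) / (u + w : ℕ) = r at *
  refine ⟨_, hA', _, hB', ?_, ?_, ?_⟩
  · have e1 : (w : ℝ) * (r * n - (γ + 12 * θ) * n) ≤ u * (A.biUnion C).card :=
      (mul_le_mul_of_nonneg_left (by linarith) (by linarith)).trans hlt.le
    have e2 : (u : ℝ) * (q * n - c * n) ≤ w * (r * n - (γ + 12 * θ) * n) := by
      have : (w : ℝ) * (γ + 12 * θ) * n ≤ u * c * n :=
        mul_le_mul_of_nonneg_right (by linarith) hn'.le
      linear_combination this + (n : ℝ) * hwu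
    have e3 := le_of_mul_le_mul_left (e2.trans e1) (by linarith : (0 : ℝ) < u)
    linarith
  · have e1 : (w : ℝ) * (kb - (B.biUnion C).card) ≤ w * ((r + (γ + 12 * θ)) * n) := by
      have h1 : (u : ℝ) * (A.biUnion C).card ≤ u * ((q + (γ + 12 * θ)) * n) := by
        refine mul_le_mul_of_nonneg_left ?_ (by linarith)
        rw [hsplit] at hD2
        linarith
      have h2 : (u : ℝ) * (γ + 12 * θ) * n ≤ w * (γ + 12 * θ) * n :=
        mul_le_mul_of_nonneg_right (by linarith) hn'.le
      linear_combination hlt.le + h1 + h2 + (n : ℝ) * hwu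
    have e2 := le_of_mul_le_mul_left e1 (by linarith : (0 : ℝ) < w)
    have e3 : 2 * (γ + 12 * θ) * n ≤ c * n :=
      mul_le_mul_of_nonneg_right (by linarith) hn'.le
    have e4 : 0 < θ * n := mul_pos hθ hn'
    rw [hsplit] at e2
    linarith
  · have e1 : eAB G (A.biUnion C) (B.biUnion C) = ∑ x ∈ A, ∑ y ∈ B, eAB G (C x) (C y) := by
      rw [eAB_biUnion_left G _ A C fun x _ y _ h => hCd x y h]
      exact sum_congr rfl fun x _ => eAB_biUnion_right G _ B C fun x _ y _ h => hCd x y h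
    have e2 : (eAB G (A.biUnion C) (B.biUnion C) : ℝ) ≤ 6 * θ * n * (A.biUnion C).card := by
      rw [e1, hcA, mul_sum]
      push_cast
      refine sum_le_sum fun x hx => le_trans ?_ (hnon x)
      refine sum_le_sum_of_subset_of_nonneg (fun y hy => ?_) fun _ _ _ => Nat.cast_nonneg _
      refine mem_filter.2 ⟨mem_univ _, ?_, hAB x hx y hy⟩
      rw [hB y hy, hA x hx]
    have e3 : 6 * θ * n * (A.biUnion C).card ≤ 6 * θ * n * n :=
      mul_le_mul_of_nonneg_left hAn (by positivity)
    have e4 : 6 * θ * (n : ℝ) ^ 2 ≤ c * (n : ℝ) ^ 2 :=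
      mul_le_mul_of_nonneg_right (by linarith) (by positivity)
    linarith

end Clusters

/-- A fractional tiling of the clusters yields an almost perfect tiling. -/
theorem exists_tileable_of_fractional [Fintype α] [Fintype V] {H : SimpleGraph α} {c₀ : α → Bool}
    {G : SimpleGraph V} {ι : Type*} [Fintype ι] {C : ι → Finset V} {u w : ℕ}
    (hu : (univ.filter fun a => c₀ a = false).card = u)
    (hw : (univ.filter fun a => ¬ c₀ a = false).card = w) {ω : ℝ} (hω1 : ω ≤ 1)
    (hCd : ∀ x y, x ≠ y → Disjoint (C x) (C y)) {l : ι → ι → ℝ} (hl : ∀ x y, 0 ≤ l x y)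
    (hcopy : ∀ x y, l x y ≠ 0 → ∀ P ⊆ C x, ∀ Q ⊆ C y, ω * (C x).card ≤ P.card →
      ω * (C y).card ≤ Q.card →
        ∃ f : α → V, IsCopy H G f ∧ ∀ a, f a ∈ if c₀ a = false then P else Q)
    (hsum : ∀ z, ∑ y, (u * l z y + w * l y z) = (C z).card) :
    ∃ S ⊆ univ.biUnion C, Tileable H G S ∧
      (1 - ω) * ∑ z, ((C z).card : ℝ) - (u + w) * (Fintype.card ι : ℝ) ^ 2 ≤ S.card := by
  have h1 : ∀ x y, (⌊(1 - ω) * l x y⌋₊ : ℝ) ≤ (1 - ω) * l x y := fun x y =>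
    Nat.floor_le (mul_nonneg (by linarith) (hl x y))
  obtain ⟨S, hS, hST, hSc⟩ := exists_packing (H := H) (G := G) hu hw
    (fun z => ω * ((C z).card : ℝ)) _ (fun x y => ⌊(1 - ω) * l x y⌋₊) C rfl hCd
    (fun x y hxy => hcopy x y fun h => hxy (by simp [h]))
    (by
      intro z
      have h2 : ((∑ y, (u * ⌊(1 - ω) * l z y⌋₊ + w * ⌊(1 - ω) * l y z⌋₊) : ℕ) : ℝ) ≤
          (1 - ω) * ∑ y, (u * l z y + w * l y z) := by
        rw [mul_sum]
        push_cast
        refine sum_le_sum fun y _ => ?_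
        have e1 := mul_le_mul_of_nonneg_left (h1 z y) (Nat.cast_nonneg (α := ℝ) u)
        have e2 := mul_le_mul_of_nonneg_left (h1 y z) (Nat.cast_nonneg (α := ℝ) w)
        linarith
      rw [hsum z] at h2
      linarith)
  refine ⟨S, hS, hST, ?_⟩
  rw [hSc]
  have h2 : ∑ z, ((C z).card : ℝ) = (u + w) * ∑ x, ∑ y, l x y := by
    simp only [← hsum, sum_add_distrib, ← mul_sum]
    rw [sum_comm (f := fun x y => l y x)]
    ring
  have h3 : (1 - ω) * ∑ x, ∑ y, l x y - (Fintype.card ι : ℝ) ^ 2 ≤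
      ∑ x, ∑ y, (⌊(1 - ω) * l x y⌋₊ : ℝ) := by
    have : (Fintype.card ι : ℝ) ^ 2 = ∑ _x : ι, ∑ _y : ι, (1 : ℝ) := by
      simp [sq]
    rw [this, mul_sum, ← sum_sub_distrib]
    refine sum_le_sum fun x _ => ?_
    rw [mul_sum, ← sum_sub_distrib]
    exact sum_le_sum fun y _ => (Nat.sub_one_lt_floor _).le
  rw [h2]
  push_cast
  have := mul_le_mul_of_nonneg_left h3 (by positivity : (0 : ℝ) ≤ u + w)
  linarith

theorem exists_almost_tiling [Fintype α] {H : SimpleGraph α} {c₀ : α → Bool}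
    (hc₀ : Proper2Coloring H c₀) {u w : ℕ}
    (hu : (univ.filter fun a => c₀ a = false).card = u)
    (hw : (univ.filter fun a => ¬ c₀ a = false).card = w) (hu0 : 1 ≤ u) (huw : u < w)
    {c : ℝ} (hc : 0 < c) :
    ∃ γ : ℝ, 0 < γ ∧ ∀ ω : ℝ, 0 < ω → ∃ n₁ : ℕ, ∀ (V : Type) [Fintype V] (G : SimpleGraph V)
      (Z : Bool → Finset V) (n : ℕ), n₁ ≤ n → Fintype.card V = 2 * n →
      Disjoint (Z false) (Z true) → (∀ b, (1 - γ) * n ≤ (Z b).card) → (∀ b, (Z b).card ≤ n) →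
      (∀ b, ∀ v ∈ Z b, ((u : ℝ) / (u + w : ℕ) - γ) * n ≤ degIn G v (Z (!b))) →
      (∃ b, ∃ A ⊆ Z b, ∃ B ⊆ Z (!b), ((w : ℝ) / (u + w : ℕ) - c) * n ≤ A.card ∧
        ((w : ℝ) / (u + w : ℕ) - c) * n ≤ B.card ∧ (eAB G A B : ℝ) ≤ c * (n : ℝ) ^ 2) ∨
      ∃ S ⊆ Z false ∪ Z true, Tileable H G S ∧
        ((Z false).card : ℝ) + (Z true).card ≤ S.card + ω * n := by
  have hu' : (1 : ℝ) ≤ u := by exact_mod_cast hu0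
  have huw' : (u : ℝ) + 1 ≤ w := by exact_mod_cast huw
  have hh : (0 : ℝ) < (u : ℝ) + w := by linarith
  set e : ℝ := min c (1 / 2) / (4 * (u + w)) with he
  have hm : 0 < min c (1 / 2) := lt_min hc (by norm_num)
  have hepos : 0 < e := by positivity
  have hee : (u + w) * (e + e) ≤ min c (1 / 2) := by
    rw [he]
    field_simp
    linarith
  refine ⟨e, hepos, fun ω hω => ?_⟩
  obtain ⟨θ, hθ, hθe, hθω, hθ1⟩ : ∃ θ : ℝ, 0 < θ ∧ 12 * θ ≤ e ∧ 12 * θ ≤ ω / 4 ∧ θ ≤ 1 / 4 :=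
    ⟨min (1 / 4) (min (e / 12) (ω / 48)), by positivity,
      by linarith [(min_le_right (1 / 4 : ℝ) _).trans (min_le_left (e / 12) (ω / 48))],
      by linarith [(min_le_right (1 / 4 : ℝ) _).trans (min_le_right (e / 12) (ω / 48))],
      min_le_left _ _⟩
  obtain ⟨ω', hω', hω'1, hω'ω⟩ : ∃ ω' : ℝ, 0 < ω' ∧ ω' ≤ 1 ∧ 2 * ω' ≤ ω / 4 :=
    ⟨min 1 (ω / 8), by positivity, min_le_left _ _, by linarith [min_le_right (1 : ℝ) (ω / 8)]⟩
  obtain ⟨K, κ, hκ, n₁, hcl⟩ := exists_clusters hθ hθ1 hω' hω'1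
  obtain ⟨N₀, hN₀⟩ := exists_copy_of_dense (H := H) hc₀ (d := θ / 2) (μ := ω' * κ) (by positivity)
    (by positivity)
  refine ⟨n₁ + N₀ + ⌈2 * ((u + w) * (K : ℝ) ^ 2) / ω⌉₊ + 1, ?_⟩
  intro V _ G Z n hn hV hZd hZl hZu hdeg
  obtain ⟨ι, _, side, C, R, hιK, hCd, hCZ, hRs, hRside, hreg, hloss, hnon⟩ :=
    hcl V G Z n (by omega) hV hZu hZd
  have hncast : 2 * ((u + w) * (K : ℝ) ^ 2) / ω ≤ n :=
    (Nat.le_ceil _).trans (Nat.cast_le.2 (by omega))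
  rcases exists_fractional_tiling side (fun x => ((C x).card : ℝ)) (fun _ => Nat.cast_nonneg _)
    R hRs (u := u) (w := w) (by linarith) (by linarith) with
    ⟨l, hl0, hlR, hlsum⟩ | ⟨b, A, B, hA, hB, hAB, hlt⟩
  · right
    obtain ⟨S, hS, hST, hSc⟩ := exists_tileable_of_fractional (H := H) (G := G) hu hw hω'1 hCd hl0
      (fun x y hxy P hP Q hQ hPc hQc => by
        have hr := hlR x y hxy
        have h1 := hreg x y hr
        have h2 := (hreg y x (hRs x y hr)).1
        refine hN₀ V G P Q (by omega) ?_ ?_ (h1.2 P hP Q hQ hPc hQc)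
        · rw [mul_assoc]
          exact (mul_le_mul_of_nonneg_left h1.1 hω'.le).trans hPc
        · rw [mul_assoc]
          exact (mul_le_mul_of_nonneg_left h2 hω'.le).trans hQc) hlsum
    refine ⟨S, hS.trans (biUnion_subset.2 fun z _ => (hCZ z).trans ?_), hST, ?_⟩
    · cases side z
      · exact subset_union_left
      · exact subset_union_right
    have hsplit : ∑ z, ((C z).card : ℝ) = ∑ z with side z = false, ((C z).card : ℝ) +
        ∑ z with side z = true, ((C z).card : ℝ) := by
      rw [← sum_filter_add_sum_filter_not univ (fun z => side z = false)]
      simp only [Bool.not_eq_false]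
    have h1 := hloss false
    have h2 := hloss true
    have hle : ∀ b, ∑ z with side z = b, ((C z).card : ℝ) ≤ n := by
      intro b
      rw [← card_biUnion_clusters hCd]
      exact_mod_cast (card_le_card (biUnion_clusters_subset hCZ fun x hx =>
        (mem_filter.1 hx).2)).trans (hZu b)
    have h3 : ω' * ∑ z, ((C z).card : ℝ) ≤ ω' * (2 * n) := by
      refine mul_le_mul_of_nonneg_left ?_ hω'.le
      linarith [hle false, hle true]
    have h4 : (u + w) * (Fintype.card ι : ℝ) ^ 2 ≤ ω / 2 * n := by
      have : (u + w) * (Fintype.card ι : ℝ) ^ 2 ≤ (u + w) * (K : ℝ) ^ 2 := by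
        have : (Fintype.card ι : ℝ) ≤ K := by exact_mod_cast hιK
        gcongr
      rw [div_le_iff₀ hω] at hncast
      linarith
    have h5 : 12 * θ * n ≤ ω / 4 * n := mul_le_mul_of_nonneg_right hθω (Nat.cast_nonneg _)
    have h6 : 2 * ω' * n ≤ ω / 4 * n := mul_le_mul_of_nonneg_right hω'ω (Nat.cast_nonneg _)
    linarith
  · left
    have hce : (u + w) * (e + 12 * θ) ≤ min c (1 / 2) :=
      (mul_le_mul_of_nonneg_left (by linarith) hh.le).trans hee
    exact ⟨b, exists_sparse_pair hCd hCZ hRs hloss hnon hθ hu0 huw hepos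
      (hce.trans (min_le_left _ _)) (by linarith [min_le_right c (1 / 2)]) (by omega) hZl hZu hdeg
      hA hB hAB hlt⟩

/-! ### Assembling the factor -/

theorem colorCard_true_add_false [Fintype α] (c : α → Bool) :
    colorCard c true + colorCard c false = Fintype.card α := by
  have := card_filter_add_card_filter_not (s := (univ : Finset α)) fun v => c v = true
  simpa [colorCard] using this

/-- Some proper colouring realises `σ(H)` by its `false` class, and `σ(H) < h / 2`. -/
theorem exists_min_coloring [Fintype α] {H : SimpleGraph α} (hbip : IsBip H) (hhcf : HcfOne H) :
    ∃ c₀ : α → Bool, Proper2Coloring H c₀ ∧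
      (univ.filter fun a => c₀ a = false).card = sigmaBip H ∧
      (univ.filter fun a => ¬ c₀ a = false).card = Fintype.card α - sigmaBip H ∧
      sigmaBip H < Fintype.card α - sigmaBip H := by
  have hlt : sigmaBip H < Fintype.card α - sigmaBip H := by
    obtain ⟨c, hc, hcd⟩ : ∃ c : α → Bool, Proper2Coloring H c ∧ colorDiff c ≠ 0 := by
      by_contra! hcon
      exact hhcf.2.1.ne' (Finset.gcd_eq_zero_iff.2 fun c hc => hcon c (mem_filter.1 hc).2)
    have h1 : sigmaBip H ≤ min (colorCard c true) (colorCard c false) :=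
      Nat.sInf_le ⟨c, hc, rfl⟩
    have h2 := colorCard_true_add_false c
    rw [colorDiff] at hcd
    omega
  obtain ⟨c, hc, hcs⟩ : ∃ c : α → Bool, Proper2Coloring H c ∧
      sigmaBip H = min (colorCard c true) (colorCard c false) := by
    obtain ⟨c, hc⟩ := hbip
    exact Nat.sInf_mem (s := {k | ∃ c : α → Bool, Proper2Coloring H c ∧
      k = min (colorCard c true) (colorCard c false)}) ⟨_, c, hc, rfl⟩
  have key : ∀ c : α → Bool, Proper2Coloring H c → sigmaBip H = colorCard c false →
      ∃ c₀ : α → Bool, Proper2Coloring H c₀ ∧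
        (univ.filter fun a => c₀ a = false).card = sigmaBip H ∧
        (univ.filter fun a => ¬ c₀ a = false).card = Fintype.card α - sigmaBip H := by
    intro c hc hs
    refine ⟨c, hc, hs.symm, ?_⟩
    have h1 := colorCard_true_add_false c
    simp only [Bool.not_eq_false]
    change colorCard c true = _
    omega
  suffices ∃ c₀ : α → Bool, Proper2Coloring H c₀ ∧
      (univ.filter fun a => c₀ a = false).card = sigmaBip H ∧
      (univ.filter fun a => ¬ c₀ a = false).card = Fintype.card α - sigmaBip H by
    obtain ⟨c₀, h1, h2, h3⟩ := this
    exact ⟨c₀, h1, h2, h3, hlt⟩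
  rcases le_total (colorCard c false) (colorCard c true) with h | h
  · exact key c hc (by rw [hcs, min_eq_right h])
  · refine key (fun a => !c a) (fun a b hab hcc => hc hab (Bool.not_inj hcc)) ?_
    rw [hcs, min_eq_left h]
    simp [colorCard]

theorem tileable_of_forall_not_adj [Fintype α] [Fintype V] {H : SimpleGraph α} {G : SimpleGraph V}
    (hH : ∀ a b, ¬ H.Adj a b) (m : ℕ) :
    ∀ S : Finset V, S.card = m * Fintype.card α → Tileable H G S := by
  induction m with
  | zero =>
    intro S hS
    rw [zero_mul, card_eq_zero] at hS
    exact hS ▸ tileable_empty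
  | succ m ih =>
    intro S hS
    obtain ⟨T, hTS, hT⟩ := exists_subset_card_eq (s := S) (n := Fintype.card α)
      (by rw [hS]; exact Nat.le_mul_of_pos_left _ m.succ_pos)
    let e : α ≃ T := Fintype.equivOfCardEq (by rw [Fintype.card_coe, hT])
    have hcopy : IsCopy H G fun a => (e a : V) :=
      ⟨fun a b hab => e.injective (Subtype.ext hab), fun a b hab => (hH a b hab).elim⟩
    have himg : univ.image (fun a => (e a : V)) = T := by
      ext x
      simp only [mem_image, mem_univ, true_and]
      exact ⟨fun ⟨a, ha⟩ => ha ▸ (e a).2, fun hx => ⟨e.symm ⟨x, hx⟩, by simp⟩⟩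
    have h1 := hcopy.tileable
    rw [himg] at h1
    have h2 := ih (S \ T) (by rw [card_sdiff_of_subset hTS, hS, hT, Nat.succ_mul]; omega)
    have := h1.union h2 disjoint_sdiff
    rwa [union_sdiff_of_subset hTS] at this

theorem exists_resize {X A : Finset V} (hA : A ⊆ X) {t : ℕ} (ht : t ≤ X.card) {r : ℝ}
    (hr : 0 ≤ r) (htA : (t : ℝ) ≤ A.card + r) :
    ∃ A' ⊆ X, A'.card = t ∧ ((A' \ A).card : ℝ) ≤ r := by
  rcases le_total t A.card with h | h
  · obtain ⟨A', hA', hc⟩ := exists_subset_card_eq h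
    refine ⟨A', hA'.trans hA, hc, ?_⟩
    rw [sdiff_eq_empty_iff_subset.2 hA']
    simpa using hr
  · obtain ⟨A', h1, h2, hc⟩ := exists_subsuperset_card_eq hA h ht
    refine ⟨A', h2, hc, ?_⟩
    have : ((A' \ A).card : ℝ) + A.card = A'.card := by
      exact_mod_cast card_sdiff_add_card_eq_card h1
    rw [hc] at this
    linarith

theorem eAB_le_add_of_sdiff (G : SimpleGraph V) (A A' B B' : Finset V) :
    eAB G A' B' ≤ eAB G A B + (A' \ A).card * B'.card + A'.card * (B' \ B).card := by
  have hmono : eAB G (A' ∩ A) (B' ∩ B) ≤ eAB G A B :=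
    card_le_card (filter_subset_filter _ (product_subset_product inter_subset_right
      inter_subset_right))
  have h1 : eAB G A' B' ≤ eAB G A' (B' ∩ B) + A'.card * (B' \ B).card := by
    refine (eAB_le_add_sdiff G (U := B' ∩ B) inter_subset_left).trans ?_
    rw [sdiff_inter_self_left]
  have h2 : eAB G A' (B' ∩ B) ≤ eAB G (A' ∩ A) (B' ∩ B) + (A' \ A).card * B'.card := by
    rw [eAB_comm, eAB_comm G (A' ∩ A)]
    refine (eAB_le_add_sdiff G (U := A' ∩ A) inter_subset_left).trans ?_
    rw [sdiff_inter_self_left, mul_comm]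
    exact Nat.add_le_add_left (Nat.mul_le_mul_left _ (card_le_card inter_subset_left)) _
  omega

theorem extremalWith_of_sparse [Fintype V] {G : SimpleGraph V} {X Y A B : Finset V} {n u w : ℕ}
    (huw : u < w) (hn : 4 ≤ n) (hX : X.card = n) (hY : Y.card = n) {c a : ℝ} (hc : 0 < c)
    (hca : 48 * c ≤ a) (hA : A ⊆ X) (hB : B ⊆ Y)
    (hAc : ((w : ℝ) / (u + w : ℕ) - c) * n ≤ A.card)
    (hBc : ((w : ℝ) / (u + w : ℕ) - c) * n ≤ B.card)
    (hAB : (eAB G A B : ℝ) ≤ c * (n : ℝ) ^ 2) : ExtremalWith G X Y w (u + w) a := by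
  have hn' : (0 : ℝ) < n := by exact_mod_cast (by omega : 0 < n)
  obtain ⟨t, ht⟩ : ∃ t, t = w * n / (u + w) := ⟨_, rfl⟩
  have htn : t ≤ n := by
    rw [ht]
    refine Nat.div_le_of_le_mul ?_
    exact Nat.mul_le_mul_right n (Nat.le_add_left w u)
  have htu : (t : ℝ) ≤ (w : ℝ) / (u + w : ℕ) * n := by
    rw [ht, div_mul_eq_mul_div]
    exact_mod_cast Nat.cast_div_le (α := ℝ) (m := w * n) (n := u + w)
  have htl : (n : ℝ) ≤ 4 * t := by
    have : n ≤ 4 * t := by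
      have h1 := Nat.lt_mul_div_succ (w * n) (by omega : 0 < u + w)
      rw [← ht] at h1
      by_contra! h2
      have h3 : 4 * (t + 1) ≤ 2 * n := by omega
      have h4 := Nat.mul_le_mul_left (u + w) h3
      have h5 : (u + w) * n < 2 * w * n := Nat.mul_lt_mul_of_pos_right (by omega) (by omega)
      nlinarith
    exact_mod_cast this
  have hcn : 0 ≤ c * (n : ℝ) := by positivity
  obtain ⟨A', hA', hA'c, hA'd⟩ := exists_resize hA (t := t) (hX ▸ htn) hcn (by linarith)
  obtain ⟨B', hB', hB'c, hB'd⟩ := exists_resize hB (t := t) (hY ▸ htn) hcn (by linarith)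
  refine ⟨A', hA', B', hB', by rw [hA'c, hX, ht], by rw [hB'c, hX, ht], ?_⟩
  have ht0 : (0 : ℝ) < t := by linarith
  have htn' : (t : ℝ) ≤ n := by exact_mod_cast htn
  have h1 : (eAB G A' B' : ℝ) ≤ eAB G A B + (A' \ A).card * B'.card + A'.card * (B' \ B).card := by
    exact_mod_cast eAB_le_add_of_sdiff G A A' B B'
  rw [dens, hA'c, hB'c, div_le_iff₀ (by positivity)]
  rw [hA'c, hB'c] at h1
  have h2 : ((A' \ A).card : ℝ) * t ≤ c * n * n := by gcongr
  have h3 : (t : ℝ) * (B' \ B).card ≤ n * (c * n) := by gcongr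
  have h4 : (n : ℝ) * n ≤ 4 * t * (4 * t) := by gcongr
  have h5 : 3 * c * (n * n) ≤ 3 * c * (4 * t * (4 * t)) := by gcongr
  have h6 : 48 * c * (t * t) ≤ a * (t * t) := by gcongr
  linarith

theorem BipartiteWith.degree_le [Fintype V] {G : SimpleGraph V} {X Y : Finset V}
    (hG : BipartiteWith G X Y) (A : Finset V) {v : V} :
    (v ∈ X → G.degree v ≤ degIn G v (Y \ A) + A.card) ∧
      (v ∈ Y → G.degree v ≤ degIn G v (X \ A) + A.card) := by
  have key : ∀ Y' : Finset V, (∀ x, G.Adj v x → x ∈ Y') →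
      G.degree v ≤ degIn G v (Y' \ A) + A.card := by
    intro Y' h
    rw [degIn, ← G.card_neighborFinset_eq_degree]
    refine (card_le_card fun x hx => ?_).trans (card_union_le _ _)
    rw [SimpleGraph.mem_neighborFinset] at hx
    rw [mem_union, mem_filter, mem_sdiff]
    by_cases hxA : x ∈ A
    · exact Or.inr hxA
    · exact Or.inl ⟨⟨h x hx, hxA⟩, hx⟩
  refine ⟨fun hv => key Y fun x hx => ?_, fun hv => key X fun x hx => ?_⟩
  · rcases hG.cross hx with h | h
    · exact h.2
    · exact (disjoint_left.1 hG.disj hv h.1).elim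
  · rcases hG.cross hx with h | h
    · exact (disjoint_left.1 hG.disj h.1 hv).elim
    · exact h.2

theorem BipartiteWith.card_eq [Fintype V] {G : SimpleGraph V} {X Y : Finset V}
    (hG : BipartiteWith G X Y) : Fintype.card V = X.card + Y.card := by
  rw [← card_univ, ← hG.cover, card_union_of_disjoint hG.disj]

/-- Theorem 4.1, nonextremal case. Let `H` be a bipartite graph on `h`
vertices with `hcf(H) = 1`, `u = σ(H)` and `w = h - u`. For every `a > 0` there exist `γ > 0`
and a positive integer `m₀` such that every balanced bipartite graph `G[X,Y]` on `2n = mh`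
vertices with `m ≥ m₀` and `δ(G) ≥ (u/h - γ)n` either contains an `H`-factor or has
`A ⊆ X`, `B ⊆ Y` with `|A| = |B| = ⌊wn/h⌋` and `d(A,B) ≤ a`. -/
theorem statement_10 {α : Type*} [Fintype α] (H : SimpleGraph α) (h u w : ℕ)
    (hh : Fintype.card α = h) (hbip : IsBip H) (hhcf : HcfOne H)
    (hu : u = sigmaBip H) (hw : w = h - u)
    (a : ℝ) (ha : 0 < a) :
    ∃ γ : ℝ, 0 < γ ∧ ∃ m₀ : ℕ, 0 < m₀ ∧
      ∀ (V : Type) [Fintype V], ∀ (G : SimpleGraph V) (X Y : Finset V) (m n : ℕ),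
        m₀ ≤ m → 2 * n = m * h → BipartiteWith G X Y → X.card = n → Y.card = n →
        (∀ v : V, ((u : ℝ) / h - γ) * n ≤ G.degree v) →
        HasHFactor H G ∨ ExtremalWith G X Y w h a := by
  obtain ⟨c₀, hc₀, hcu, hcw, huw⟩ := exists_min_coloring hbip hhcf
  rw [hh, ← hu, ← hw] at hcw huw
  rw [← hu] at hcu
  obtain rfl : h = u + w := by omega
  have hhpos : 0 < u + w := by omega
  rcases Nat.eq_zero_or_pos u with h0 | hu0
  · refine ⟨1, one_pos, 1, one_pos, fun V _ G X Y m n _ hmn hG hX hY _ => Or.inl ?_⟩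
    refine tileable_of_forall_not_adj (fun x y hxy => hc₀ hxy ?_) m univ ?_
    · rw [h0, card_eq_zero, filter_eq_empty_iff] at hcu
      have := fun v => hcu (mem_univ v)
      simp only [Bool.not_eq_false] at this
      rw [this x, this y]
    · rw [card_univ, hG.card_eq, hX, hY, hh, ← hmn]
      ring
  have : Nonempty α := Fintype.card_pos_iff.1 (by omega)
  have hu' : (0 : ℝ) < u := by exact_mod_cast hu0
  have hh' : (0 : ℝ) < (u + w : ℕ) := by exact_mod_cast hhpos
  obtain ⟨γ, hγ, htiling⟩ := exists_almost_tiling hc₀ hcu hcw hu0 huw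
    (c := a / 48) (by positivity)
  obtain ⟨q, hq⟩ : ∃ q : ℝ, q = (u : ℝ) / (u + w : ℕ) := ⟨_, rfl⟩
  have hq0 : 0 < q := hq ▸ by positivity
  rw [← hq] at htiling ⊢
  obtain ⟨ω, hω, N₀, habs⟩ := exists_absorbing hbip hhcf (c := q / 4) (by positivity)
    (η := γ / 4) (by positivity)
  obtain ⟨n₁, hn₁⟩ := htiling (2 * ω) (by positivity)
  refine ⟨min (γ / 2) (q / 2), by positivity, n₁ + N₀ + 4, by omega, ?_⟩
  intro V _ G X Y m n hm hmn hG hX hY hdeg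
  have hV : Fintype.card V = 2 * n := by rw [hG.card_eq, hX, hY]; ring
  have hmn' : m ≤ n := by nlinarith
  have hVr : (Fintype.card V : ℝ) = 2 * n := by exact_mod_cast hV
  have hn0 : (0 : ℝ) ≤ n := Nat.cast_nonneg n
  have hdeg1 : ∀ v, (q - γ / 2) * n ≤ G.degree v := fun v =>
    (mul_le_mul_of_nonneg_right (by linarith [min_le_left (γ / 2) (q / 2)]) hn0).trans (hdeg v)
  have hdeg2 : ∀ v, q / 2 * n ≤ G.degree v := fun v =>
    (mul_le_mul_of_nonneg_right (by linarith [min_le_right (γ / 2) (q / 2)]) hn0).trans (hdeg v)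
  obtain ⟨A, hAt, hAc, hAabs⟩ := habs V G (by omega) fun v => by
    rw [hVr]; linarith [hdeg2 v]
  rw [hVr] at hAc
  obtain ⟨Z, hZf, hZt⟩ : ∃ Z : Bool → Finset V, Z false = X \ A ∧ Z true = Y \ A :=
    ⟨fun b => bif b then Y \ A else X \ A, rfl, rfl⟩
  have hlow : ∀ T : Finset V, T.card = n → (1 - γ) * n ≤ ((T \ A).card : ℝ) := by
    intro T hT
    have h1 : (T.card : ℝ) ≤ (T \ A).card + A.card := by
      exact_mod_cast card_le_card_sdiff_add_card
    rw [hT] at h1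
    have : 0 ≤ γ * n := by positivity
    linarith
  have hZdeg : ∀ b, ∀ v ∈ Z b, (q - γ) * n ≤ degIn G v (Z (!b)) := by
    intro b v hv
    have h1 : (G.degree v : ℝ) ≤ degIn G v (Z (!b)) + A.card := by
      cases b
      · rw [hZf] at hv
        rw [Bool.not_false, hZt]
        exact_mod_cast (hG.degree_le A).1 (mem_sdiff.1 hv).1
      · rw [hZt] at hv
        rw [Bool.not_true, hZf]
        exact_mod_cast (hG.degree_le A).2 (mem_sdiff.1 hv).1
    linarith [hdeg1 v]
  have hZle : ∀ b, (Z b).card ≤ n := by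
    rintro (_ | _)
    · rw [hZf, ← hX]; exact card_le_card sdiff_subset
    · rw [hZt, ← hY]; exact card_le_card sdiff_subset
  have hZd : Disjoint (Z false) (Z true) := by
    rw [hZf, hZt]
    exact disjoint_of_subset_left sdiff_subset (disjoint_of_subset_right sdiff_subset hG.disj)
  rcases hn₁ V G Z n (by omega) hV hZd
    (by rintro (_ | _); exacts [hZf ▸ hlow X hX, hZt ▸ hlow Y hY]) hZle hZdeg with
    ⟨b, A', hA', B', hB', h1, h2, h3⟩ | ⟨S, hS, hST, hSc⟩
  · right
    cases b
    · rw [hZf] at hA'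
      rw [Bool.not_false, hZt] at hB'
      exact extremalWith_of_sparse huw (by omega) hX hY (by positivity) (by linarith)
        (hA'.trans sdiff_subset) (hB'.trans sdiff_subset) h1 h2 h3
    · rw [hZt] at hA'
      rw [Bool.not_true, hZf] at hB'
      rw [eAB_comm] at h3
      exact extremalWith_of_sparse huw (by omega) hX hY (by positivity) (by linarith)
        (hB'.trans sdiff_subset) (hA'.trans sdiff_subset) h2 h1 h3
  · left
    have hZu : Z false ∪ Z true = univ \ A := by
      rw [hZf, hZt, ← union_sdiff_distrib, hG.cover]
    have hZcard : (Z false).card + (Z true).card + A.card = 2 * n := by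
      rw [← card_union_of_disjoint hZd, hZu, ← hV, ← card_univ]
      exact card_sdiff_add_card_eq_card (subset_univ A)
    have hSA : Disjoint A S :=
      disjoint_of_subset_right (hZu ▸ hS) disjoint_sdiff
    have hWcard : (univ \ (A ∪ S)).card + (A.card + S.card) = 2 * n := by
      rw [← card_union_of_disjoint hSA, ← hV, ← card_univ]
      exact card_sdiff_add_card_eq_card (subset_univ _)
    have hWd : Disjoint (A ∪ S) (univ \ (A ∪ S)) := disjoint_sdiff
    have hAW := hAabs (univ \ (A ∪ S)) (disjoint_of_subset_left subset_union_left hWd)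
      (by
        have e1 : ((univ \ (A ∪ S)).card : ℝ) + (A.card + S.card) = 2 * n := by
          exact_mod_cast hWcard
        have e2 : ((Z false).card : ℝ) + (Z true).card + A.card = 2 * n := by
          exact_mod_cast hZcard
        rw [hVr]
        linarith)
      (by
        refine (Nat.dvd_add_left (hAt.dvd_card.add hST.dvd_card)).1 ?_
        rw [hWcard, hmn, hh]
        exact dvd_mul_left _ _)
    have hfin := hAW.union hST (disjoint_union_left.2
      ⟨hSA, (disjoint_of_subset_left subset_union_right hWd).symm⟩)
    have hcover : A ∪ univ \ (A ∪ S) ∪ S = univ := by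
      rw [union_right_comm]
      exact union_sdiff_of_subset (subset_univ _)
    rw [hcover] at hfin
    exact hfin

end BipTiling
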